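/- arXiv:1108.4904 — 2 statements merged into one kernel-verified Lean document; each statement's English description precedes it below -/
import Mathlib

section
/- Let k ≥ 3 and let m be an integer with 0 < m < 2k+1 and gcd(m, 2k+1) = 1. Set q = exp(2mπi/(2k+1)) (the same holds for q = exp(−2mπi/(2k+1))). Then the group homomorphism from the presented group ⟨x, y | x^{2k+1} = y^{2k+1} = (xy)^{2k+1} = 1, (x⁻¹y^k)² = 1, (y^k x^{k−1})³ = 1⟩ to PGL(2,ℂ) sending x to [A(q)] and y to [B(q)] is injective with image Γ(q); in particular Γ(q) is isomorphic to the triangle group Δ(2,3,2k+1). -/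
open Matrix

/-- The matrix `A(q)` (image of `g₁²` under the reduced Burau representation `β₋q`),
as an element of `GL(2,ℂ)` (junk value `1` if `q = 0`). -/
noncomputable def AGL (q : ℂ) : GL (Fin 2) ℂ :=
  if h : q = 0 then 1 else
    Matrix.GeneralLinearGroup.mkOfDetNeZero !![q ^ 2, 1 + q; 0, 1]
      (by rw [Matrix.det_fin_two_of]; simpa using pow_ne_zero 2 h)

/-- The matrix `B(q)` (image of `g₂²` under the reduced Burau representation `β₋q`),
as an element of `GL(2,ℂ)` (junk value `1` if `q = 0`). -/
noncomputable def BGL (q : ℂ) : GL (Fin 2) ℂ :=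
  if h : q = 0 then 1 else
    Matrix.GeneralLinearGroup.mkOfDetNeZero !![1, 0; -q - q ^ 2, q ^ 2]
      (by rw [Matrix.det_fin_two_of]; simpa using pow_ne_zero 2 h)

/-- `PGL(2,ℂ)`: the quotient of `GL(2,ℂ)` by its center. -/
abbrev PGL2 : Type := GL (Fin 2) ℂ ⧸ Subgroup.center (GL (Fin 2) ℂ)

/-- The canonical projection `GL(2,ℂ) → PGL(2,ℂ)`. -/
noncomputable def pgl : GL (Fin 2) ℂ →* PGL2 := QuotientGroup.mk' _

/-- The class `[A(q)] ∈ PGL(2,ℂ)`. -/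
noncomputable def Apr (q : ℂ) : PGL2 := pgl (AGL q)

/-- The class `[B(q)] ∈ PGL(2,ℂ)`. -/
noncomputable def Bpr (q : ℂ) : PGL2 := pgl (BGL q)

/-- The group `Γ(q) = Γ₋q ⊆ PGL(2,ℂ)` generated by `[A(q)]` and `[B(q)]`. -/
noncomputable def Gamma (q : ℂ) : Subgroup PGL2 := Subgroup.closure {Apr q, Bpr q}

/-- Relators of the triangle group `Δ(l,m,n) = ⟨x,y | x^l = y^m = (xy)^n = 1⟩`. -/
def triangleRels (l m n : ℕ) : Set (FreeGroup (Fin 2)) :=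
  {(FreeGroup.of 0) ^ l, (FreeGroup.of 1) ^ m, (FreeGroup.of 0 * FreeGroup.of 1) ^ n}

/-- The triangle group `Δ(l,m,n)`. -/
abbrev Triangle (l m n : ℕ) := PresentedGroup (triangleRels l m n)

/-- Relators of the presented group
`⟨x,y | x^(2k+1) = y^(2k+1) = (xy)^(2k+1) = (x⁻¹y^k)² = (y^k x^(k-1))³ = 1⟩`. -/
def oddRels (k : ℕ) : Set (FreeGroup (Fin 2)) :=
  {(FreeGroup.of 0) ^ (2 * k + 1), (FreeGroup.of 1) ^ (2 * k + 1),
   (FreeGroup.of 0 * FreeGroup.of 1) ^ (2 * k + 1),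
   ((FreeGroup.of 0)⁻¹ * (FreeGroup.of 1) ^ k) ^ 2,
   ((FreeGroup.of 1) ^ k * (FreeGroup.of 0) ^ (k - 1)) ^ 3}

section Tits

/-- The alternating sequence `t, s, t, s, …`. -/
def altLetter {I : Type*} (s t : I) (j : ℕ) : I := if Even j then t else s

/-- The product of `j` alternating generators ending with `σ t` on the right. -/
def altProd {G I : Type*} [Group G] (σ : I → G) (s t : I) : ℕ → G
  | 0 => 1
  | j + 1 => σ (altLetter s t j) * altProd σ s t j

theorem altLetter_add_two {I : Type*} (s t : I) (j : ℕ) :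
    altLetter s t (j + 2) = altLetter s t j := by
  simp [altLetter, Nat.even_add]

theorem altLetter_cases {I : Type*} (s t : I) (j : ℕ) :
    (altLetter s t j = t ∧ altLetter s t (j + 1) = s) ∨
      (altLetter s t j = s ∧ altLetter s t (j + 1) = t) := by
  by_cases h : Even j
  · left; simp [altLetter, h, Nat.even_add_one]
  · right; simp [altLetter, h, Nat.even_add_one]

theorem mul_mul_pow_mul {G : Type*} [Group G] (x y : G) (n : ℕ) :
    x * (y * x) ^ n * y = (x * y) ^ (n + 1) := by
  induction n with
  | zero => simp
  | succ n ih => rw [pow_succ, pow_succ (x * y), ← ih]; group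

theorem altProd_conj {G I : Type*} [Group G] (σ : I → G) (hinv : ∀ i, σ i * σ i = 1)
    (s t : I) (j : ℕ) :
    σ (altLetter s t j) * altProd σ s t j * σ s * (altProd σ s t j)⁻¹ =
      (σ (altLetter s t j) * σ (altLetter s t (j + 1))) ^ (j + 1) := by
  induction j with
  | zero => simp [altProd, altLetter]
  | succ j ih =>
    have hi : (σ (altLetter s t j))⁻¹ = σ (altLetter s t j) := inv_eq_of_mul_eq_one_left (hinv _)
    rw [altLetter_add_two, ← mul_mul_pow_mul, ← ih, altProd, _root_.mul_inv_rev, hi]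
    group

theorem altProd_succ_mul {G I : Type*} [Group G] (σ : I → G) (hinv : ∀ i, σ i * σ i = 1)
    (s t : I) (j : ℕ) (hst : (σ s * σ t) ^ (j + 1) = 1) (hts : (σ t * σ s) ^ (j + 1) = 1) :
    altProd σ s t (j + 1) * σ s = altProd σ s t j := by
  have h := altProd_conj σ hinv s t j
  have h1 : (σ (altLetter s t j) * σ (altLetter s t (j + 1))) ^ (j + 1) = 1 := by
    rcases altLetter_cases s t j with ⟨h1, h2⟩ | ⟨h1, h2⟩ <;> rw [h1, h2] <;> assumption
  rw [h1] at h
  exact mul_inv_eq_one.mp h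

theorem length_mul_altProd_le {G I : Type*} [Group G] (σ : I → G) (ℓ : G → ℕ)
    (hℓ : ∀ w i, ℓ (w * σ i) ≤ ℓ w + 1) (s t : I) (j : ℕ) (v : G) :
    ℓ (v * altProd σ s t j) ≤ ℓ v + j := by
  induction j generalizing v with
  | zero => simp [altProd]
  | succ j ih =>
    rw [altProd, ← mul_assoc]
    have h1 := ih (v * σ (altLetter s t j))
    have h2 := hℓ v (altLetter s t j)
    omega

theorem altProd_apply_root {G I V : Type*} [Group G] [AddCommGroup V] [Module ℝ V]
    (σ : I → G) (ρ : G →* Module.End ℝ V) (α : I → V) (s t : I) (θ : ℝ)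
    (hθ : Real.sin θ ≠ 0)
    (hss : ρ (σ s) (α s) = -α s) (htt : ρ (σ t) (α t) = -α t)
    (hst : ρ (σ s) (α t) = α t + (2 * Real.cos θ) • α s)
    (hts : ρ (σ t) (α s) = α s + (2 * Real.cos θ) • α t) (j : ℕ) :
    ρ (altProd σ s t j) (α s) =
      (Real.sin ((j + 1) * θ) / Real.sin θ) • α (altLetter s t (j + 1)) +
        (Real.sin (j * θ) / Real.sin θ) • α (altLetter s t j) := by
  induction j with
  | zero => simp [altProd, altLetter, hθ]
  | succ j ih =>
    have h1 : ρ (σ (altLetter s t j)) (α (altLetter s t j)) = -α (altLetter s t j) := by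
      rcases altLetter_cases s t j with ⟨h1, h2⟩ | ⟨h1, h2⟩ <;> rw [h1] <;> assumption
    have h2 : ρ (σ (altLetter s t j)) (α (altLetter s t (j + 1))) =
        α (altLetter s t (j + 1)) + (2 * Real.cos θ) • α (altLetter s t j) := by
      rcases altLetter_cases s t j with ⟨h1, h2⟩ | ⟨h1, h2⟩ <;> rw [h1, h2] <;> assumption
    have h3 : Real.sin (((j + 1 : ℕ) + 1) * θ) =
        2 * Real.cos θ * Real.sin ((j + 1) * θ) - Real.sin (j * θ) := by
      have e1 : ((j + 1 : ℕ) + 1 : ℝ) * θ = (j + 1) * θ + θ := by push_cast; ring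
      have e2 : (j : ℝ) * θ = (j + 1) * θ - θ := by ring
      rw [e1, e2, Real.sin_add, Real.sin_sub]; ring
    rw [altProd, map_mul, Module.End.mul_apply, ih, map_add, map_smul, map_smul, h1, h2,
      altLetter_add_two, h3]
    push_cast
    module

/-- Positivity half of Tits' argument: a group element which does not get shorter by right
multiplication with a generator sends the corresponding simple root into the positive cone. -/
theorem apply_root_mem_span {G I V : Type*} [Group G] [AddCommGroup V] [Module ℝ V]
    (σ : I → G) (hinv : ∀ i, σ i * σ i = 1) (m : I → I → ℕ) (hm : ∀ s t, s ≠ t → 2 ≤ m s t)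
    (hsymm : ∀ s t, m s t = m t s) (hrel : ∀ s t, (σ s * σ t) ^ m s t = 1)
    (ρ : G →* Module.End ℝ V) (α : I → V) (hdiag : ∀ s, ρ (σ s) (α s) = -α s)
    (hρ : ∀ s t, s ≠ t → ρ (σ s) (α t) = α t + (2 * Real.cos (Real.pi / m s t)) • α s)
    (ℓ : G → ℕ) (hℓ : ∀ w i, ℓ (w * σ i) ≤ ℓ w + 1)
    (hdesc : ∀ w, w ≠ 1 → ∃ i, ℓ (w * σ i) < ℓ w) (w : G) (s : I) (hw : ℓ w ≤ ℓ (w * σ s)) :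
    ρ w (α s) ∈ Submodule.span NNReal (Set.range α) := by
  induction hN : ℓ w using Nat.strong_induction_on generalizing w s with
  | _ N ih =>
  subst hN
  have hmem : ∀ i, α i ∈ Submodule.span NNReal (Set.range α) :=
    fun i => Submodule.subset_span ⟨i, rfl⟩
  by_cases hw1 : w = 1
  · subst hw1; simpa using hmem s
  obtain ⟨t, ht⟩ := hdesc w hw1
  have hst : s ≠ t := by rintro rfl; omega
  have hm2 := hm s t hst
  have hcancel : ∀ (v : G) (i : I), v * σ i * σ i = v := fun v i => by
    rw [mul_assoc, hinv, mul_one]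
  let P : ℕ → Prop := fun j => ∃ v, w = v * altProd σ s t j ∧ ℓ v + j = ℓ w
  have hP1 : P 1 := by
    refine ⟨w * σ t, by simp [altProd, altLetter, hcancel], ?_⟩
    have := hℓ (w * σ t) t
    rw [hcancel] at this
    omega
  classical
  obtain ⟨j, hj1, hjm, hPj, hmax⟩ :
      ∃ j, 1 ≤ j ∧ j ≤ m s t ∧ P j ∧ (j + 1 ≤ m s t → ¬ P (j + 1)) :=
    ⟨Nat.findGreatest P (m s t), Nat.le_findGreatest (by omega) hP1, Nat.findGreatest_le _,
      Nat.findGreatest_spec (P := P) (by omega : 1 ≤ m s t) hP1,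
      fun h => Nat.findGreatest_is_greatest (Nat.lt_succ_self _) h⟩
  obtain ⟨i, rfl⟩ : ∃ i, j = i + 1 := ⟨j - 1, by omega⟩
  obtain ⟨v, hv, hvl⟩ := hPj
  have hlt : i + 1 < m s t := by
    refine lt_of_le_of_ne hjm fun h => ?_
    have h1 := hrel s t
    have h2 := hrel t s
    rw [← hsymm s t, ← h] at h2
    rw [← h] at h1
    have h3 := altProd_succ_mul σ hinv s t i h1 h2
    rw [hv, mul_assoc v, h3, ← hv] at hw
    have := length_mul_altProd_le σ ℓ hℓ s t i v
    omega
  have hc1 : ρ v (α (altLetter s t (i + 1))) ∈ Submodule.span NNReal (Set.range α) := by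
    refine ih (ℓ v) (by omega) v _ ?_ rfl
    by_contra hcon
    refine hmax hlt ⟨v * σ (altLetter s t (i + 1)), ?_, ?_⟩
    · rw [altProd, ← mul_assoc, hcancel]; exact hv
    · have := hℓ (v * σ (altLetter s t (i + 1))) (altLetter s t (i + 1))
      rw [hcancel] at this
      omega
  have hc2 : ρ v (α (altLetter s t (i + 2))) ∈ Submodule.span NNReal (Set.range α) := by
    refine ih (ℓ v) (by omega) v _ ?_ rfl
    by_contra hcon
    rw [altLetter_add_two] at hcon
    have := length_mul_altProd_le σ ℓ hℓ s t i (v * σ (altLetter s t i))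
    rw [mul_assoc, ← altProd, ← hv] at this
    omega
  have hmpos : (0 : ℝ) < m s t := by exact_mod_cast (by omega : 0 < m s t)
  have hm2' : (2 : ℝ) ≤ m s t := by exact_mod_cast hm2
  have hsin : ∀ x : ℕ, x ≤ m s t → 0 ≤ Real.sin (x * (Real.pi / m s t)) := fun x hx => by
    apply Real.sin_nonneg_of_nonneg_of_le_pi
    · positivity
    · rw [mul_div_assoc', div_le_iff₀ hmpos, mul_comm]
      have : (x : ℝ) ≤ m s t := by exact_mod_cast hx
      gcongr
  have hsinpos : 0 < Real.sin (Real.pi / m s t) := by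
    apply Real.sin_pos_of_pos_of_lt_pi
    · positivity
    · rw [div_lt_iff₀ hmpos]; nlinarith [Real.pi_pos]
  have key := altProd_apply_root σ ρ α s t _ hsinpos.ne' (hdiag s) (hdiag t) (hρ s t hst)
    (by rw [hsymm s t]; exact hρ t s hst.symm) (i + 1)
  have hsmul : ∀ (c : ℝ), 0 ≤ c → ∀ x ∈ Submodule.span NNReal (Set.range α),
      c • x ∈ Submodule.span NNReal (Set.range α) := fun c hc x hx =>
    Submodule.smul_mem _ (⟨c, hc⟩ : NNReal) hx
  rw [hv, map_mul, Module.End.mul_apply, key, map_add, map_smul, map_smul]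
  refine Submodule.add_mem _ (hsmul _ (div_nonneg ?_ hsinpos.le) _ hc2)
    (hsmul _ (div_nonneg ?_ hsinpos.le) _ hc1)
  · have := hsin (i + 2) (by omega)
    push_cast at this ⊢
    rwa [add_assoc, one_add_one_eq_two]
  · exact hsin (i + 1) (by omega)

theorem exists_wordLength {G I : Type*} [Group G] (σ : I → G) (hinv : ∀ i, σ i * σ i = 1)
    (hgen : Subgroup.closure (Set.range σ) = ⊤) :
    ∃ ℓ : G → ℕ, (∀ w i, ℓ (w * σ i) ≤ ℓ w + 1) ∧ ∀ w, w ≠ 1 → ∃ i, ℓ (w * σ i) < ℓ w := by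
  classical
  have hex : ∀ w : G, ∃ n : ℕ, ∃ l : List I, (l.map σ).prod = w ∧ l.length = n := by
    intro w
    suffices ∃ l : List I, (l.map σ).prod = w by
      obtain ⟨l, hl⟩ := this; exact ⟨_, l, hl, rfl⟩
    have hw : w ∈ Subgroup.closure (Set.range σ) := hgen ▸ Subgroup.mem_top w
    induction hw using Subgroup.closure_induction_right with
    | one => exact ⟨[], rfl⟩
    | mul_right x _ y hy ih =>
      obtain ⟨l, hl⟩ := ih
      obtain ⟨i, rfl⟩ := hy
      exact ⟨l ++ [i], by simp [hl]⟩
    | mul_inv_cancel x _ y hy ih =>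
      obtain ⟨l, hl⟩ := ih
      obtain ⟨i, rfl⟩ := hy
      exact ⟨l ++ [i], by simp [hl, inv_eq_of_mul_eq_one_left (hinv i)]⟩
  refine ⟨fun w => Nat.find (hex w), fun w i => ?_, fun w hw => ?_⟩
  · obtain ⟨l, hl, hn⟩ := Nat.find_spec (hex w)
    exact Nat.find_min' _ ⟨l ++ [i], by simp [hl], by simp [hn]⟩
  · obtain ⟨l, hl, hn⟩ := Nat.find_spec (hex w)
    rcases List.eq_nil_or_concat l with rfl | ⟨l', i, rfl⟩
    · exact absurd hl.symm hw
    · refine ⟨i, lt_of_le_of_lt (Nat.find_min' _ ⟨l', ?_, rfl⟩)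
        (?_ : l'.length < Nat.find (hex w))⟩
      · rw [← hl]; simp [mul_assoc, hinv]
      · rw [← hn]; simp

/-- **Tits' faithfulness argument** for a group generated by involutions satisfying the Coxeter
relations, acting by the geometric representation. -/
theorem eq_one_of_geometric_rep {G I V : Type*} [Group G] [AddCommGroup V] [Module ℝ V]
    (σ : I → G) (hinv : ∀ i, σ i * σ i = 1) (hgen : Subgroup.closure (Set.range σ) = ⊤)
    (m : I → I → ℕ) (hm : ∀ s t, s ≠ t → 2 ≤ m s t)
    (hsymm : ∀ s t, m s t = m t s) (hrel : ∀ s t, (σ s * σ t) ^ m s t = 1)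
    (ρ : G →* Module.End ℝ V) (α : I → V) (hdiag : ∀ s, ρ (σ s) (α s) = -α s)
    (hρ : ∀ s t, s ≠ t → ρ (σ s) (α t) = α t + (2 * Real.cos (Real.pi / m s t)) • α s)
    (f : V →ₗ[ℝ] ℝ) (hf : ∀ i, 0 < f (α i)) (w : G) (hw : ρ w = 1) : w = 1 := by
  obtain ⟨ℓ, hℓ, hdesc⟩ := exists_wordLength σ hinv hgen
  by_contra hw1
  obtain ⟨s, hs⟩ := hdesc w hw1
  have h := apply_root_mem_span σ hinv m hm hsymm hrel ρ α hdiag hρ ℓ hℓ hdesc (w * σ s) s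
    (by rw [mul_assoc, hinv, mul_one]; exact hs.le)
  rw [map_mul, hw, one_mul, hdiag] at h
  have hpos : ∀ x ∈ Submodule.span NNReal (Set.range α), 0 ≤ f x := by
    intro x hx
    induction hx using Submodule.span_induction with
    | mem x hx => obtain ⟨i, rfl⟩ := hx; exact (hf i).le
    | zero => simp
    | add x y _ _ hx hy => rw [map_add]; exact add_nonneg hx hy
    | smul c x _ hx =>
      have : f (c • x) = (c : ℝ) * f x := by rw [NNReal.smul_def, map_smul, smul_eq_mul]
      rw [this]; exact mul_nonneg c.2 hx
  have h2 := hpos _ h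
  rw [map_neg] at h2
  linarith [hf s]

end Tits

/-- The class in `PGL(2,ℂ)` of a matrix (junk value `1` if the matrix is singular). -/
noncomputable def pglClass (M : Matrix (Fin 2) (Fin 2) ℂ) : PGL2 :=
  if h : M.det ≠ 0 then pgl (Matrix.GeneralLinearGroup.mkOfDetNeZero M h) else 1

theorem pglClass_val (g : GL (Fin 2) ℂ) : pglClass g.val = pgl g := by
  have h : g.val.det ≠ 0 := g.det.ne_zero
  rw [pglClass, dif_pos h]
  congr 1
  ext i j
  rfl

theorem exists_val_eq {M : Matrix (Fin 2) (Fin 2) ℂ} (h : M.det ≠ 0) :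
    ∃ g : GL (Fin 2) ℂ, g.val = M :=
  ⟨Matrix.GeneralLinearGroup.mkOfDetNeZero M h, rfl⟩

theorem pglClass_mul {M N : Matrix (Fin 2) (Fin 2) ℂ} (hM : M.det ≠ 0) (hN : N.det ≠ 0) :
    pglClass (M * N) = pglClass M * pglClass N := by
  obtain ⟨g, rfl⟩ := exists_val_eq hM
  obtain ⟨h, rfl⟩ := exists_val_eq hN
  rw [← Units.val_mul, pglClass_val, pglClass_val, pglClass_val, map_mul]

theorem pglClass_one : pglClass 1 = 1 := by
  rw [← Units.val_one, pglClass_val, map_one]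

theorem pglClass_pow {M : Matrix (Fin 2) (Fin 2) ℂ} (hM : M.det ≠ 0) (n : ℕ) :
    pglClass (M ^ n) = pglClass M ^ n := by
  obtain ⟨g, rfl⟩ := exists_val_eq hM
  rw [← Units.val_pow_eq_pow_val, pglClass_val, pglClass_val, map_pow]

theorem pglClass_eq_one_iff {M : Matrix (Fin 2) (Fin 2) ℂ} (hM : M.det ≠ 0) :
    pglClass M = 1 ↔ M 0 1 = 0 ∧ M 1 0 = 0 ∧ M 0 0 = M 1 1 := by
  obtain ⟨g, rfl⟩ := exists_val_eq hM
  rw [pglClass_val, pgl, QuotientGroup.mk'_apply, QuotientGroup.eq_one_iff,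
    Matrix.GeneralLinearGroup.mem_center_iff_val_mem_range_scalar]
  constructor
  · rintro ⟨a, ha⟩
    rw [← ha]
    simp
  · rintro ⟨h1, h2, h3⟩
    refine ⟨g.val 0 0, ?_⟩
    ext i j
    fin_cases i <;> fin_cases j <;> simp [h1, h2, h3]

theorem pglClass_smul_one {c : ℂ} (hc : c ≠ 0) : pglClass (c • 1) = 1 :=
  (pglClass_eq_one_iff (by simp [hc])).mpr (by simp)

theorem pglClass_smul {c : ℂ} (hc : c ≠ 0) {M : Matrix (Fin 2) (Fin 2) ℂ} (hM : M.det ≠ 0) :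
    pglClass (c • M) = pglClass M := by
  have h : c • M = (c • 1 : Matrix (Fin 2) (Fin 2) ℂ) * M := by simp
  rw [h, pglClass_mul (by simp [hc]) hM, pglClass_smul_one hc, one_mul]

/-- Conjugation of matrices as an action of `GL(2,ℂ)`. -/
noncomputable def conjGL : GL (Fin 2) ℂ →* Module.End ℝ (Matrix (Fin 2) (Fin 2) ℂ) where
  toFun g := LinearMap.mulLeftRight ℝ (g.val, (g⁻¹).val)
  map_one' := by ext1 x; simp
  map_mul' g h := by ext1 x; simp [mul_assoc]

/-- Conjugation of matrices as an action of `PGL(2,ℂ)`. -/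
noncomputable def conjPGL : PGL2 →* Module.End ℝ (Matrix (Fin 2) (Fin 2) ℂ) :=
  QuotientGroup.lift _ conjGL (by
    intro g hg
    rw [Matrix.GeneralLinearGroup.mem_center_iff_val_mem_range_scalar] at hg
    obtain ⟨a, ha⟩ := hg
    have hc : ∀ x : Matrix (Fin 2) (Fin 2) ℂ, g.val * x = x * g.val := fun x => by
      rw [← ha]; exact (Matrix.scalar_commute a (fun r => Commute.all a r) x)
    refine LinearMap.ext fun x => ?_
    change g.val * x * (g⁻¹).val = x
    rw [hc, mul_assoc, ← Units.val_mul, mul_inv_cancel, Units.val_one, mul_one])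

theorem conjPGL_pglClass {M X Y : Matrix (Fin 2) (Fin 2) ℂ} (hM : M.det ≠ 0)
    (h : M * X = Y * M) : conjPGL (pglClass M) X = Y := by
  obtain ⟨g, rfl⟩ := exists_val_eq hM
  rw [pglClass_val]
  change g.val * X * (g⁻¹).val = Y
  rw [h, mul_assoc, ← Units.val_mul, mul_inv_cancel, Units.val_one, mul_one]

section Presentation

theorem conj_pow' {G : Type*} [Group G] (g x : G) (n : ℕ) :
    (g⁻¹ * x * g) ^ n = g⁻¹ * x ^ n * g := by
  simpa using conj_pow (a := g⁻¹) (b := x) (i := n)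

theorem inv_sq_pow_of_pow_eq_one {G : Type*} [Group G] {u : G} {k : ℕ} (hu : u ^ (2 * k + 1) = 1) :
    ((u⁻¹) ^ 2) ^ k = u := by
  rw [← pow_mul, inv_pow, inv_eq_iff_mul_eq_one, ← pow_succ]
  exact hu

/-- If `a² = (au)³ = 1` then `u⁻²a` is conjugate to `u`. -/
theorem inv_sq_mul_eq_conj {G : Type*} [Group G] {a u : G} (ha : a ^ 2 = 1)
    (hau : (a * u) ^ 3 = 1) : (u⁻¹) ^ 2 * a = (a * u)⁻¹ * u * (a * u) := by
  have ha' : a⁻¹ = a := inv_eq_of_mul_eq_one_left (by rw [← sq, ha])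
  have h : a * u * (a * u) = (a * u)⁻¹ := by
    rw [eq_inv_iff_mul_eq_one]
    rw [pow_succ, sq] at hau
    exact hau
  calc (u⁻¹) ^ 2 * a = u⁻¹ * (a * u)⁻¹ := by rw [_root_.mul_inv_rev, ha', sq, mul_assoc]
    _ = u⁻¹ * (a * u * (a * u)) := by rw [h]
    _ = (a * u)⁻¹ * u * (a * u) := by rw [_root_.mul_inv_rev, ha']; group

section

variable {G : Type*} [Group G] {a u : G} {k : ℕ}

theorem inv_mul_conj_pow_eq (ha : a ^ 2 = 1) (hau : (a * u) ^ 3 = 1) (hu : u ^ (2 * k + 1) = 1) :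
    ((u⁻¹) ^ 2)⁻¹ * ((a * u)⁻¹ * (u⁻¹) ^ 2 * (a * u)) ^ k = a := by
  rw [conj_pow', inv_sq_pow_of_pow_eq_one hu, ← inv_sq_mul_eq_conj ha hau, inv_mul_cancel_left]

theorem oddRels_of_triangle (hk : 1 ≤ k) (ha : a ^ 2 = 1) (hau : (a * u) ^ 3 = 1)
    (hu : u ^ (2 * k + 1) = 1) :
    ∀ r ∈ oddRels k,
      FreeGroup.lift ![(u⁻¹) ^ 2, (a * u)⁻¹ * (u⁻¹) ^ 2 * (a * u)] r = 1 := by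
  have hx : ((u⁻¹) ^ 2) ^ (2 * k + 1) = 1 := by
    rw [← pow_mul, mul_comm, pow_mul, inv_pow, hu, inv_one, one_pow]
  have hconj := inv_sq_mul_eq_conj ha hau
  have ha' : a⁻¹ = a := inv_eq_of_mul_eq_one_left (by rw [← sq, ha])
  rintro r (rfl | rfl | rfl | rfl | rfl)
  · simpa using hx
  · simp only [map_pow, FreeGroup.lift_apply_of, Matrix.cons_val_one, Matrix.cons_val_fin_one]
    rw [conj_pow', hx]
    group
  · simp only [map_pow, map_mul, FreeGroup.lift_apply_of, Matrix.cons_val_zero, Matrix.cons_val_one,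
      Matrix.cons_val_fin_one]
    have h : (u⁻¹) ^ 2 * ((a * u)⁻¹ * (u⁻¹) ^ 2 * (a * u)) =
        u⁻¹ * (((u⁻¹) ^ 2 * a) ^ 2) * u := by
      rw [_root_.mul_inv_rev, ha', pow_two ((u⁻¹) ^ 2 * a)]; group
    rw [h, hconj, conj_pow', conj_pow', conj_pow', ← pow_mul, mul_comm, pow_mul, hu]
    group
  · simp only [map_pow, map_mul, map_inv, FreeGroup.lift_apply_of, Matrix.cons_val_zero,
      Matrix.cons_val_one, Matrix.cons_val_fin_one]
    rw [inv_mul_conj_pow_eq ha hau hu, ha]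
  · simp only [map_pow, map_mul, FreeGroup.lift_apply_of, Matrix.cons_val_zero,
      Matrix.cons_val_one, Matrix.cons_val_fin_one]
    have h1 : ((u⁻¹) ^ 2) ^ (k - 1) = u * u ^ 2 := by
      rw [pow_sub _ hk, inv_sq_pow_of_pow_eq_one hu]; simp
    have h2 : (u⁻¹) ^ 2 * a * (u * u ^ 2) = (u ^ 2)⁻¹ * (a * u) * u ^ 2 := by group
    rw [conj_pow', inv_sq_pow_of_pow_eq_one hu, ← hconj, h1, h2, conj_pow', hau]
    group

theorem triangleRels_of_ab {b : G} {n : ℕ} (ha : a ^ 2 = 1) (hb : b ^ 3 = 1)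
    (hab : (a * b) ^ n = 1) : ∀ r ∈ triangleRels 2 3 n, FreeGroup.lift ![a, b] r = 1 := by
  rintro r (rfl | rfl | rfl) <;> simpa

theorem triangle_of_oddRels {x y : G} (hk : 1 ≤ k)
    (h5 : (y ^ k * x ^ (k - 1)) ^ 3 = 1) :
    (x⁻¹ * y ^ k * x ^ k) ^ 3 = 1 := by
  have h : x⁻¹ * y ^ k * x ^ k = x⁻¹ * (y ^ k * x ^ (k - 1)) * x := by
    rw [mul_assoc, mul_assoc, mul_assoc, ← pow_succ, Nat.sub_add_cancel hk]
  rw [h, conj_pow', h5]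
  group

theorem eq_conj_of_oddRels {x y : G} (hx : x ^ (2 * k + 1) = 1) (hy : y ^ (2 * k + 1) = 1)
    (h4 : (x⁻¹ * y ^ k) ^ 2 = 1) (hb : (x⁻¹ * y ^ k * x ^ k) ^ 3 = 1) :
    ((x ^ k)⁻¹) ^ 2 = x ∧
      (x⁻¹ * y ^ k * x ^ k)⁻¹ * x * (x⁻¹ * y ^ k * x ^ k) = y := by
  have hz : ∀ z : G, z ^ (2 * k + 1) = 1 → ((z ^ k)⁻¹) ^ 2 = z := fun z hz => by
    rw [inv_pow, ← pow_mul, mul_comm, inv_eq_iff_mul_eq_one, ← pow_succ]; exact hz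
  refine ⟨hz x hx, ?_⟩
  have h := inv_sq_mul_eq_conj h4 hb
  rw [hz x hx, mul_inv_cancel_left] at h
  have hconj : ∀ g z : G, ((g⁻¹ * z * g)⁻¹) ^ 2 = g⁻¹ * (z⁻¹) ^ 2 * g := fun g z => by
    rw [← conj_pow']; group
  have e := hconj (x⁻¹ * y ^ k * x ^ k) (x ^ k)
  rw [← h, hz y hy, hz x hx] at e
  exact e.symm

theorem ab_of_oddRels {x y : G} (hx : x ^ (2 * k + 1) = 1) (h4 : (x⁻¹ * y ^ k) ^ 2 = 1) :
    (x⁻¹ * y ^ k * (x⁻¹ * y ^ k * x ^ k)) ^ (2 * k + 1) = 1 := by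
  rw [← mul_assoc, ← sq, h4, one_mul, ← pow_mul, mul_comm, pow_mul, hx, one_pow]

end

theorem mem_triangleRels {n : ℕ} :
    (PresentedGroup.of 0 : Triangle 2 3 n) ^ 2 = 1 ∧ (PresentedGroup.of 1 : Triangle 2 3 n) ^ 3 = 1 ∧
      (PresentedGroup.of 0 * PresentedGroup.of 1 : Triangle 2 3 n) ^ n = 1 :=
  ⟨PresentedGroup.one_of_mem (rels := triangleRels 2 3 n) (by simp [triangleRels]),
    PresentedGroup.one_of_mem (rels := triangleRels 2 3 n) (by simp [triangleRels]),
    PresentedGroup.one_of_mem (rels := triangleRels 2 3 n) (by simp [triangleRels])⟩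

theorem oddRels_hold {k : ℕ} (x y : PresentedGroup (oddRels k)) (hx : x = .of 0) (hy : y = .of 1) :
    x ^ (2 * k + 1) = 1 ∧ y ^ (2 * k + 1) = 1 ∧ (x⁻¹ * y ^ k) ^ 2 = 1 ∧
      (y ^ k * x ^ (k - 1)) ^ 3 = 1 := by
  subst hx hy
  exact ⟨PresentedGroup.one_of_mem (rels := oddRels k) (by simp [oddRels]),
    PresentedGroup.one_of_mem (rels := oddRels k) (by simp [oddRels]),
    PresentedGroup.one_of_mem (rels := oddRels k) (by simp [oddRels]),
    PresentedGroup.one_of_mem (rels := oddRels k) (by simp [oddRels])⟩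

theorem mul_mul_of_sq {G : Type*} [Group G] {a b : G} (ha : a ^ 2 = 1) : a * (a * b) = b := by
  rw [← mul_assoc, ← sq, ha, one_mul]

/-- The two presentations of the `(2,3,2k+1)` triangle group are equivalent. -/
theorem exists_oddEquivTriangle (k : ℕ) (hk : 1 ≤ k) :
    ∃ e : PresentedGroup (oddRels k) ≃* Triangle 2 3 (2 * k + 1),
      e (.of 0) = ((.of 0 * .of 1)⁻¹) ^ 2 ∧
      e (.of 1) = (.of 1)⁻¹ * ((.of 0 * .of 1)⁻¹) ^ 2 * .of 1 := by
  obtain ⟨ha, hb, hab⟩ := mem_triangleRels (n := 2 * k + 1)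
  obtain ⟨hx, hy, h4, h5⟩ := oddRels_hold (k := k) _ _ rfl rfl
  have hb' := triangle_of_oddRels hk h5
  have hau := mul_mul_of_sq (b := (PresentedGroup.of 1 : Triangle 2 3 (2 * k + 1))) ha
  let f := PresentedGroup.toGroup (oddRels_of_triangle hk ha (by rw [hau]; exact hb) hab)
  let g := PresentedGroup.toGroup (triangleRels_of_ab h4 hb' (ab_of_oddRels hx h4))
  have hf0 := PresentedGroup.toGroup.of
    (oddRels_of_triangle hk ha (by rw [hau]; exact hb) hab) (x := 0)
  have hf1 := PresentedGroup.toGroup.of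
    (oddRels_of_triangle hk ha (by rw [hau]; exact hb) hab) (x := 1)
  have hg0 := PresentedGroup.toGroup.of (triangleRels_of_ab h4 hb' (ab_of_oddRels hx h4)) (x := 0)
  have hg1 := PresentedGroup.toGroup.of (triangleRels_of_ab h4 hb' (ab_of_oddRels hx h4)) (x := 1)
  simp only [Matrix.cons_val_zero, Matrix.cons_val_one, Matrix.cons_val_fin_one] at hf0 hf1 hg0 hg1
  obtain ⟨e1, e2⟩ := eq_conj_of_oddRels hx hy h4 hb'
  have hgf : g.comp f = MonoidHom.id _ := by
    refine PresentedGroup.ext fun i => ?_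
    fin_cases i
    · change g (f (.of 0)) = _
      simp only [f, g, hf0, hg0, hg1, map_pow, map_mul, map_inv, mul_mul_of_sq h4, e1]
      rfl
    · change g (f (.of 1)) = _
      simp only [f, g, hf1, hg0, hg1, map_pow, map_mul, map_inv, mul_mul_of_sq h4, e1, e2]
      rfl
  have hfg : f.comp g = MonoidHom.id _ := by
    have key := inv_mul_conj_pow_eq (k := k) ha (by rw [hau]; exact hb) hab
    refine PresentedGroup.ext fun i => ?_
    fin_cases i
    · change f (g (.of 0)) = _
      simp only [f, g, hf0, hf1, hg0, map_pow, map_mul, map_inv, key]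
      rfl
    · change f (g (.of 1)) = _
      simp only [f, g, hf0, hf1, hg1, map_pow, map_mul, map_inv, key,
        inv_sq_pow_of_pow_eq_one hab]
      exact hau
  exact ⟨MonoidHom.toMulEquiv f g hgf hfg, hf0, hf1.trans (by rw [hau])⟩

end Presentation

section Reps

/-- The matrix of `A(q)⁻¹ B(q)ᵏ`, up to a scalar. -/
def matA (q : ℂ) : Matrix (Fin 2) (Fin 2) ℂ := !![-q ^ 2, -(1 + q); q ^ 3, q ^ 2]

/-- The matrix of `A(q)ᵏ`, up to a scalar. -/
def matU (q : ℂ) : Matrix (Fin 2) (Fin 2) ℂ := !![1, -1; 0, q]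

/-- The product `matA q * matU q`. -/
def matB (q : ℂ) : Matrix (Fin 2) (Fin 2) ℂ := !![-q ^ 2, -q; q ^ 3, 0]

theorem det_matA (q : ℂ) : (matA q).det = q ^ 3 := by
  rw [matA, Matrix.det_fin_two_of]; ring

theorem det_matU (q : ℂ) : (matU q).det = q := by
  rw [matU, Matrix.det_fin_two_of]; ring

theorem det_matB (q : ℂ) : (matB q).det = q ^ 4 := by
  rw [matB, Matrix.det_fin_two_of]; ring

theorem matA_mul_matA (q : ℂ) : matA q * matA q = (-q ^ 3) • 1 := by
  ext i j
  fin_cases i <;> fin_cases j <;> simp [matA, Matrix.mul_apply, Fin.sum_univ_two] <;> ring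

theorem matA_mul_matB (q : ℂ) : matA q * matB q = (-q ^ 3) • matU q := by
  ext i j
  fin_cases i <;> fin_cases j <;> simp [matA, matB, matU, Matrix.mul_apply, Fin.sum_univ_two] <;> ring

theorem matB_cube (q : ℂ) : matB q ^ 3 = (q ^ 6) • 1 := by
  rw [pow_succ, sq]
  ext i j
  fin_cases i <;> fin_cases j <;> simp [matB, Matrix.mul_apply, Fin.sum_univ_two] <;> first | ring1 | (left; ring1)

theorem matU_pow (q : ℂ) (j : ℕ) : matU q ^ j = !![1, -∑ i ∈ Finset.range j, q ^ i; 0, q ^ j] := by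
  induction j with
  | zero => ext i j; fin_cases i <;> fin_cases j <;> simp
  | succ j ih =>
    rw [pow_succ', ih]
    ext i j
    fin_cases i <;> fin_cases j <;>
      simp [matU, Matrix.mul_apply, Fin.sum_univ_two, Finset.sum_range_succ, pow_succ']
    ring

variable {q : ℂ}

theorem pglClass_matA_sq (hq : q ≠ 0) : pglClass (matA q) ^ 2 = 1 := by
  have hA : (matA q).det ≠ 0 := by rw [det_matA]; positivity
  rw [sq, ← pglClass_mul hA hA, matA_mul_matA]
  exact pglClass_smul_one (by simp [hq])

theorem pglClass_matB_cube (hq : q ≠ 0) : pglClass (matB q) ^ 3 = 1 := by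
  have hB : (matB q).det ≠ 0 := by rw [det_matB]; positivity
  rw [← pglClass_pow hB, matB_cube]
  exact pglClass_smul_one (by simp [hq])

theorem pglClass_matA_mul_matB (hq : q ≠ 0) :
    pglClass (matA q) * pglClass (matB q) = pglClass (matU q) := by
  have hA : (matA q).det ≠ 0 := by rw [det_matA]; positivity
  have hB : (matB q).det ≠ 0 := by rw [det_matB]; positivity
  have hU : (matU q).det ≠ 0 := by rwa [det_matU]
  rw [← pglClass_mul hA hB, matA_mul_matB]
  exact pglClass_smul (by simp [hq]) hU

theorem pglClass_matU_pow {n : ℕ} (hn : 1 < n) (hq : IsPrimitiveRoot q n) :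
    pglClass (matU q) ^ n = 1 := by
  have hU : (matU q).det ≠ 0 := by rw [det_matU]; exact hq.ne_zero (by omega)
  rw [← pglClass_pow hU, matU_pow, hq.geom_sum_eq_zero hn, hq.pow_eq_one, neg_zero,
    ← Matrix.one_fin_two, pglClass_one]

theorem exists_triangleRep {n : ℕ} (hn : 1 < n) (hq : IsPrimitiveRoot q n) :
    ∃ ψ : Triangle 2 3 n →* PGL2,
      ψ (.of 0) = pglClass (matA q) ∧ ψ (.of 1) = pglClass (matB q) := by
  have hq0 : q ≠ 0 := hq.ne_zero (by omega)
  have h := triangleRels_of_ab (n := n) (pglClass_matA_sq hq0) (pglClass_matB_cube hq0)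
    (by rw [pglClass_matA_mul_matB hq0, pglClass_matU_pow hn hq])
  exact ⟨PresentedGroup.toGroup h, PresentedGroup.toGroup.of h, PresentedGroup.toGroup.of h⟩

theorem Apr_eq_pglClass (hq : q ≠ 0) : Apr q = pglClass !![q ^ 2, 1 + q; 0, 1] := by
  rw [Apr, ← pglClass_val, AGL, dif_neg hq]; rfl

theorem Bpr_eq_pglClass (hq : q ≠ 0) : Bpr q = pglClass !![1, 0; -q - q ^ 2, q ^ 2] := by
  rw [Bpr, ← pglClass_val, BGL, dif_neg hq]; rfl

theorem inv_pglClass_matU_sq (hq : q ≠ 0) : ((pglClass (matU q))⁻¹) ^ 2 = Apr q := by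
  have hU : (matU q).det ≠ 0 := by rwa [det_matU]
  have hA : (!![q ^ 2, 1 + q; 0, 1] : Matrix (Fin 2) (Fin 2) ℂ).det ≠ 0 := by
    rw [Matrix.det_fin_two_of]; simpa
  have hU2 : (matU q ^ 2).det ≠ 0 := by rw [Matrix.det_pow]; exact pow_ne_zero _ hU
  rw [inv_pow, inv_eq_iff_mul_eq_one, Apr_eq_pglClass hq, ← pglClass_pow hU, ← pglClass_mul hU2 hA,
    pglClass_eq_one_iff (by rw [Matrix.det_mul]; exact mul_ne_zero hU2 hA), sq]
  refine ⟨?_, ?_, ?_⟩ <;> simp [matU, Matrix.mul_apply, Fin.sum_univ_two] <;> ring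

theorem pglClass_matB_conj_Apr (hq : q ≠ 0) :
    (pglClass (matB q))⁻¹ * Apr q * pglClass (matB q) = Bpr q := by
  have hB : (matB q).det ≠ 0 := by rw [det_matB]; positivity
  have hA' : (!![q ^ 2, 1 + q; 0, 1] : Matrix (Fin 2) (Fin 2) ℂ).det ≠ 0 := by
    rw [Matrix.det_fin_two_of]; simpa
  have hB' : (!![1, 0; -q - q ^ 2, q ^ 2] : Matrix (Fin 2) (Fin 2) ℂ).det ≠ 0 := by
    rw [Matrix.det_fin_two_of]; simpa
  rw [mul_assoc, inv_mul_eq_iff_eq_mul, Apr_eq_pglClass hq, Bpr_eq_pglClass hq,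
    ← pglClass_mul hB hB', ← pglClass_mul hA' hB]
  congr 1
  ext i j
  fin_cases i <;> fin_cases j <;> simp [matB, Matrix.mul_apply, Fin.sum_univ_two] <;> ring

/-- Elements of the triangle group are represented by integral polynomial matrices in `q`. -/
theorem exists_polynomial_matrix {n : ℕ} (g : Triangle 2 3 n) :
    ∃ P : Matrix (Fin 2) (Fin 2) (Polynomial ℤ), ∀ (q : ℂ) (ψ : Triangle 2 3 n →* PGL2), q ≠ 0 →
      ψ (.of 0) = pglClass (matA q) → ψ (.of 1) = pglClass (matB q) →
        (P.map (Polynomial.aeval q)).det ≠ 0 ∧ ψ g = pglClass (P.map (Polynomial.aeval q)) := by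
  obtain ⟨w, rfl⟩ := PresentedGroup.mk_surjective _ g
  induction w using FreeGroup.induction_on with
  | C1 =>
    refine ⟨1, fun q ψ hq h0 h1 => ?_⟩
    rw [Matrix.map_one _ (map_zero _) (map_one _)]
    simp [pglClass_one]
  | of i =>
    fin_cases i
    · refine ⟨!![-.X ^ 2, -(1 + .X); .X ^ 3, .X ^ 2], fun q ψ hq h0 h1 => ?_⟩
      have h : Matrix.map !![-.X ^ 2, -(1 + .X); .X ^ 3, .X ^ 2] (Polynomial.aeval (R := ℤ) q) =
          matA q := by
        ext i j; fin_cases i <;> fin_cases j <;> simp [matA]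
      rw [h, det_matA]
      exact ⟨by positivity, h0⟩
    · refine ⟨!![-.X ^ 2, -.X; .X ^ 3, 0], fun q ψ hq h0 h1 => ?_⟩
      have h : Matrix.map !![-.X ^ 2, -.X; .X ^ 3, 0] (Polynomial.aeval (R := ℤ) q) = matB q := by
        ext i j; fin_cases i <;> fin_cases j <;> simp [matB]
      rw [h, det_matB]
      exact ⟨by positivity, h1⟩
  | inv_of i ih =>
    obtain ⟨P, hP⟩ := ih
    refine ⟨P.adjugate, fun q ψ hq h0 h1 => ?_⟩
    obtain ⟨hd, h⟩ := hP q ψ hq h0 h1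
    have e : P.adjugate.map (Polynomial.aeval q) = (P.map (Polynomial.aeval q)).adjugate :=
      RingHom.map_adjugate (Polynomial.aeval q : Polynomial ℤ →ₐ[ℤ] ℂ).toRingHom P
    have hd' : (P.map (Polynomial.aeval q)).adjugate.det ≠ 0 := by
      rw [Matrix.det_adjugate]; simpa using hd
    rw [e]
    refine ⟨hd', ?_⟩
    rw [map_inv, map_inv, h, inv_eq_iff_mul_eq_one, ← pglClass_mul hd hd', Matrix.mul_adjugate]
    exact pglClass_smul_one hd
  | mul x y ihx ihy =>
    obtain ⟨P, hP⟩ := ihx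
    obtain ⟨Q, hQ⟩ := ihy
    refine ⟨P * Q, fun q ψ hq h0 h1 => ?_⟩
    obtain ⟨hd, h⟩ := hP q ψ hq h0 h1
    obtain ⟨hd', h'⟩ := hQ q ψ hq h0 h1
    rw [Matrix.map_mul, Matrix.det_mul]
    exact ⟨mul_ne_zero hd hd', by rw [map_mul, map_mul, h, h', pglClass_mul hd hd']⟩

/-- Injectivity of the representation does not depend on the choice of the primitive root. -/
theorem injective_of_isPrimitiveRoot {n : ℕ} (hn : 0 < n) {q q' : ℂ} (hq : IsPrimitiveRoot q n)
    (hq' : IsPrimitiveRoot q' n) (ψ ψ' : Triangle 2 3 n →* PGL2)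
    (h0 : ψ (.of 0) = pglClass (matA q)) (h1 : ψ (.of 1) = pglClass (matB q))
    (h0' : ψ' (.of 0) = pglClass (matA q')) (h1' : ψ' (.of 1) = pglClass (matB q'))
    (hinj : Function.Injective ψ') : Function.Injective ψ := by
  rw [injective_iff_map_eq_one]
  intro g hg
  apply hinj
  rw [map_one]
  obtain ⟨P, hP⟩ := exists_polynomial_matrix g
  obtain ⟨hd, h⟩ := hP q ψ (hq.ne_zero (by omega)) h0 h1
  obtain ⟨hd', h'⟩ := hP q' ψ' (hq'.ne_zero (by omega)) h0' h1'
  have key : ∀ p : Polynomial ℤ, Polynomial.aeval q p = 0 → Polynomial.aeval q' p = 0 := by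
    intro p hp
    rw [minpoly.isIntegrallyClosed_dvd_iff (hq.isIntegral hn),
      ← Polynomial.cyclotomic_eq_minpoly hq hn] at hp
    rw [minpoly.isIntegrallyClosed_dvd_iff (hq'.isIntegral hn),
      ← Polynomial.cyclotomic_eq_minpoly hq' hn]
    exact hp
  rw [h, pglClass_eq_one_iff hd] at hg
  rw [h', pglClass_eq_one_iff hd']
  obtain ⟨e1, e2, e3⟩ := hg
  refine ⟨key _ e1, key _ e2, sub_eq_zero.mp ?_⟩
  have := key (P 0 0 - P 1 1) (by rw [map_sub]; exact sub_eq_zero.mpr e3)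
  rwa [map_sub] at this

end Reps

section Extended

/-- The homomorphism from `ℤˣ` determined by an involution. -/
def homOfInvolution {H : Type*} [Group H] (x : H) (hx : x * x = 1) : ℤˣ →* H where
  toFun u := if u = 1 then 1 else x
  map_one' := by simp
  map_mul' u v := by
    rcases Int.units_eq_one_or u with rfl | rfl <;>
      rcases Int.units_eq_one_or v with rfl | rfl <;> simp [hx]

theorem homOfInvolution_neg_one {H : Type*} [Group H] (x : H) (hx : x * x = 1) :
    homOfInvolution x hx (-1) = x := by
  simp [homOfInvolution]

theorem exists_flip (n : ℕ) : ∃ τ : MulAut (Triangle 2 3 n), τ * τ = 1 ∧ τ (.of 0) = .of 0 ∧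
    τ (.of 1) = .of 0 * (.of 1)⁻¹ * (.of 0)⁻¹ := by
  obtain ⟨ha, hb, hab⟩ := mem_triangleRels (n := n)
  have hrel := triangleRels_of_ab (n := n) (b := .of 0 * (.of 1)⁻¹ * (.of 0)⁻¹) ha
    (by rw [conj_pow, inv_pow, hb]; group)
    (by rw [mul_assoc (PresentedGroup.of 0), mul_mul_of_sq ha, ← _root_.mul_inv_rev, inv_pow, hab,
      inv_one])
  let f := PresentedGroup.toGroup hrel
  have hf0 : f (.of 0) = .of 0 := PresentedGroup.toGroup.of hrel
  have hf1 : f (.of 1) = .of 0 * (.of 1)⁻¹ * (.of 0)⁻¹ := PresentedGroup.toGroup.of hrel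
  have hff : f.comp f = MonoidHom.id _ := by
    refine PresentedGroup.ext fun i => ?_
    fin_cases i
    · change f (f (.of 0)) = .of 0
      rw [hf0, hf0]
    · change f (f (.of 1)) = .of 1
      simp only [hf0, hf1, map_mul, map_inv, _root_.mul_inv_rev, inv_inv]
      rw [← mul_assoc, ← mul_assoc, ← sq, ha, one_mul, mul_assoc, ← sq, inv_pow, ha, inv_one,
        mul_one]
  exact ⟨MonoidHom.toMulEquiv f f hff hff, MulEquiv.ext fun x => DFunLike.congr_fun hff x, hf0, hf1⟩

/-- The traceless matrix orthogonal to `matA q` and `matU q`. -/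
def matN (q : ℂ) : Matrix (Fin 2) (Fin 2) ℂ := !![q ^ 3, 1 + q ^ 2; q ^ 3 - q ^ 4, -q ^ 3]

theorem det_matN (q : ℂ) : (matN q).det = -q ^ 3 * (1 - q + q ^ 2) := by
  rw [matN, Matrix.det_fin_two_of]; ring

/-- The simple roots of the geometric representation, as traceless matrices. -/
def rootMat (h : ℂ) : Fin 3 → Matrix (Fin 2) (Fin 2) ℂ :=
  ![h ^ 3 • matN (h ^ 2), matN (h ^ 2) * matA (h ^ 2), h ^ 2 • (matU (h ^ 2) * matN (h ^ 2))]

theorem rootMat_mul_self (h : ℂ) (i : Fin 3) :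
    rootMat h i * rootMat h i = (h ^ 12 * (1 - h ^ 2 + h ^ 4)) • 1 := by
  ext a b
  fin_cases i <;> fin_cases a <;> fin_cases b <;>
    simp [rootMat, matN, matA, matU, Matrix.mul_apply, Fin.sum_univ_two] <;> ring

theorem rootMat_mul_zero_one (h : ℂ) :
    rootMat h 0 * rootMat h 1 = -(rootMat h 1 * rootMat h 0) := by
  ext a b
  fin_cases a <;> fin_cases b <;>
    simp [rootMat, matN, matA, Matrix.mul_apply, Fin.sum_univ_two] <;> ring

theorem rootMat_mul_one_two (h : ℂ) :
    rootMat h 1 * rootMat h 2 + rootMat h 2 * rootMat h 1 =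
      -(rootMat h 1 * rootMat h 1) := by
  ext a b
  fin_cases a <;> fin_cases b <;>
    simp [rootMat, matN, matA, matU] <;> ring

theorem rootMat_mul_zero_two (h : ℂ) :
    h • (rootMat h 0 * rootMat h 2 + rootMat h 2 * rootMat h 0) =
      (h ^ 2 + 1) • (rootMat h 0 * rootMat h 0) := by
  ext a b
  fin_cases a <;> fin_cases b <;>
    simp [rootMat, matN, matU] <;> ring

/-- The Coxeter matrix of the `(2,3,n)` triangle reflection group. -/
def triangleMatrix (n : ℕ) : Fin 3 → Fin 3 → ℕ := ![![1, 2, n], ![2, 1, 3], ![n, 3, 1]]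

theorem rootMat_anticomm {n : ℕ} {h : ℂ} (h0 : h ≠ 0)
    (hc : ((2 * Real.cos (Real.pi / n) : ℝ) : ℂ) * h = -(h ^ 2 + 1)) (i j : Fin 3) (hij : i ≠ j) :
    rootMat h i * rootMat h j + rootMat h j * rootMat h i =
      -((2 * Real.cos (Real.pi / triangleMatrix n i j)) • (rootMat h i * rootMat h i)) := by
  have h01 : rootMat h 0 * rootMat h 1 + rootMat h 1 * rootMat h 0 = 0 := by
    rw [rootMat_mul_zero_one, neg_add_cancel]
  have h12 := rootMat_mul_one_two h
  have hn1 : ((2 * Real.cos (Real.pi / n) : ℝ) : ℂ) = -(h⁻¹ * (h ^ 2 + 1)) := by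
    field_simp
    linear_combination hc
  have h02 : rootMat h 0 * rootMat h 2 + rootMat h 2 * rootMat h 0 =
      -((2 * Real.cos (Real.pi / n)) • (rootMat h 0 * rootMat h 0)) := by
    rw [← Complex.coe_smul, hn1, neg_smul, neg_neg, mul_smul, ← rootMat_mul_zero_two,
      inv_smul_smul₀ h0]
  have hself : ∀ i j, rootMat h i * rootMat h i = rootMat h j * rootMat h j := fun i j => by
    rw [rootMat_mul_self, rootMat_mul_self]
  fin_cases i <;> fin_cases j <;> first | exact absurd rfl hij | skip
  · simpa [triangleMatrix] using h01
  · simpa [triangleMatrix] using h02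
  · simpa [triangleMatrix] using (add_comm _ _).trans h01
  · simpa [triangleMatrix] using h12
  · simpa [triangleMatrix, hself 2 0] using (add_comm _ _).trans h02
  · simpa [triangleMatrix, hself 2 1] using (add_comm _ _).trans h12

/-- A complex linear functional taking the same value on all three simple roots. -/
theorem exists_pos_functional {h : ℂ} (h0 : h ≠ 0) (hD : 1 - h ^ 2 + h ^ 4 ≠ 0) :
    ∃ f : Matrix (Fin 2) (Fin 2) ℂ →ₗ[ℝ] ℝ, ∀ i, 0 < f (rootMat h i) := by
  let Y := h • matA (h ^ 2) + h ^ 3 • matU (h ^ 2) - matU (h ^ 2) * matA (h ^ 2)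
  refine ⟨Complex.reLm ∘ₗ Matrix.traceLinearMap (Fin 2) ℝ ℂ ∘ₗ
    LinearMap.mulRight ℝ ((h ^ 9 * (1 - h ^ 2 + h ^ 4))⁻¹ • Y), fun i => ?_⟩
  have key : (rootMat h i * Y).trace = h ^ 9 * (1 - h ^ 2 + h ^ 4) := by
    fin_cases i <;>
      simp [rootMat, matN, matA, matU, Y,
        Matrix.trace_fin_two] <;> ring
  have h9 : h ^ 9 * (1 - h ^ 2 + h ^ 4) ≠ 0 := mul_ne_zero (pow_ne_zero _ h0) hD
  simp only [LinearMap.comp_apply, LinearMap.mulRight_apply, Matrix.traceLinearMap_apply,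
    Matrix.mul_smul, Matrix.trace_smul, key, smul_eq_mul, inv_mul_cancel₀ h9]
  simp

theorem one_sub_add_sq_ne_zero {n : ℕ} (hn : 7 ≤ n) {q : ℂ} (hq : IsPrimitiveRoot q n) :
    1 - q + q ^ 2 ≠ 0 := by
  intro h
  have h6 : q ^ 6 = 1 := by linear_combination (q ^ 4 + q ^ 3 - q - 1) * h
  have := Nat.le_of_dvd (by norm_num) (hq.dvd_of_pow_eq_one 6 h6)
  omega

theorem matA_mul_matN (q : ℂ) : matA q * matN q = -(matN q * matA q) := by
  ext i j
  fin_cases i <;> fin_cases j <;> simp [matA, matN, Matrix.mul_apply, Fin.sum_univ_two] <;> ring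

theorem matB_flip (q : ℂ) :
    matA q * matB q * (matA q * (matN q * matB q)) = (-q ^ 7) • matN q := by
  ext i j
  fin_cases i <;> fin_cases j <;>
    simp [matA, matB, matN, Matrix.mul_apply, Fin.sum_univ_two] <;> ring

theorem matN_mul_self (q : ℂ) : matN q * matN q = (q ^ 3 * (1 - q + q ^ 2)) • 1 := by
  ext i j
  fin_cases i <;> fin_cases j <;> simp [matN, Matrix.mul_apply, Fin.sum_univ_two] <;> ring

theorem closure_triangle_reflections {n : ℕ} {φ : ℤˣ →* MulAut (Triangle 2 3 n)}
    (r : Triangle 2 3 n ⋊[φ] ℤˣ) (hr : r = SemidirectProduct.inr (-1))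
    (ι : Triangle 2 3 n →* Triangle 2 3 n ⋊[φ] ℤˣ) (hι : ι = SemidirectProduct.inl) :
    Subgroup.closure (Set.range ![r, r * ι (.of 0), ι (.of 0 * .of 1) * r]) = ⊤ := by
  set H := Subgroup.closure (Set.range ![r, r * ι (.of 0), ι (.of 0 * .of 1) * r]) with hH
  have hrH : r ∈ H := Subgroup.subset_closure ⟨0, rfl⟩
  have ha : ι (.of 0) ∈ H :=
    (Subgroup.mul_mem_cancel_left H hrH).mp (Subgroup.subset_closure ⟨1, rfl⟩)
  have hab : ι (.of 0 * .of 1) ∈ H :=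
    (Subgroup.mul_mem_cancel_right H hrH).mp (Subgroup.subset_closure ⟨2, rfl⟩)
  have hb : ι (.of 1) ∈ H := by
    rw [map_mul] at hab
    exact (Subgroup.mul_mem_cancel_left H ha).mp hab
  rw [eq_top_iff]
  rintro w -
  rw [← SemidirectProduct.inl_left_mul_inr_right w]
  refine H.mul_mem ?_ ?_
  · rw [← hι]
    refine PresentedGroup.generated_by (triangleRels 2 3 n) (H.comap ι) (fun i => ?_) w.left
    fin_cases i
    · exact ha
    · exact hb
  · rcases Int.units_eq_one_or w.right with h | h <;> rw [h]
    · rw [map_one]; exact H.one_mem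
    · rw [← hr]; exact hrH

theorem mul_pow_eq_one_symm {G : Type*} [Group G] {x y : G} (hx : x * x = 1) (hy : y * y = 1)
    {n : ℕ} (h : (x * y) ^ n = 1) : (y * x) ^ n = 1 := by
  have : y * x = (x * y)⁻¹ := by
    rw [_root_.mul_inv_rev, inv_eq_of_mul_eq_one_left hx, inv_eq_of_mul_eq_one_left hy]
  rw [this, inv_pow, h, inv_one]

theorem injective_triangleRep {n : ℕ} (hn : 7 ≤ n) {h : ℂ}
    (hc : ((2 * Real.cos (Real.pi / n) : ℝ) : ℂ) * h = -(h ^ 2 + 1))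
    (hprim : IsPrimitiveRoot (h ^ 2) n) (ψ : Triangle 2 3 n →* PGL2)
    (hψ0 : ψ (.of 0) = pglClass (matA (h ^ 2))) (hψ1 : ψ (.of 1) = pglClass (matB (h ^ 2))) :
    Function.Injective ψ := by
  have hq : h ^ 2 ≠ 0 := hprim.ne_zero (by omega)
  have h0 : h ≠ 0 := fun e => hq (by simp [e])
  have hD : 1 - h ^ 2 + (h ^ 2) ^ 2 ≠ 0 := one_sub_add_sq_ne_zero hn hprim
  have hA : (matA (h ^ 2)).det ≠ 0 := by rw [det_matA]; positivity
  have hB : (matB (h ^ 2)).det ≠ 0 := by rw [det_matB]; positivity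
  have hU : (matU (h ^ 2)).det ≠ 0 := by rwa [det_matU]
  have hN : (matN (h ^ 2)).det ≠ 0 := by rw [det_matN]; simpa [h0] using hD
  have hdet : ∀ i, (rootMat h i).det ≠ 0 := by
    intro i
    fin_cases i
    · simpa [rootMat, h0] using hN
    · simpa [rootMat] using ⟨hN, hA⟩
    · simpa [rootMat, h0] using ⟨hU, hN⟩
  obtain ⟨τ, hττ, hτ0, hτ1⟩ := exists_flip n
  obtain ⟨ha, hb, hab⟩ := mem_triangleRels (n := n)
  have hNN : pglClass (matN (h ^ 2)) * pglClass (matN (h ^ 2)) = 1 := by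
    rw [← pglClass_mul hN hN, matN_mul_self]
    exact pglClass_smul_one (mul_ne_zero (pow_ne_zero _ hq) hD)
  let flip := homOfInvolution τ hττ
  let ν := homOfInvolution (pglClass (matN (h ^ 2))) hNN
  have hflip : flip (-1) = τ := homOfInvolution_neg_one _ _
  have hν : ν (-1) = pglClass (matN (h ^ 2)) := homOfInvolution_neg_one _ _
  have hcompat : ∀ g : ℤˣ, ψ.comp (flip g).toMonoidHom =
      (MulAut.conj (ν g)).toMonoidHom.comp ψ := by
    intro g
    rcases Int.units_eq_one_or g with rfl | rfl
    · rw [map_one, map_one, map_one]; rfl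
    · rw [hflip, hν]
      refine PresentedGroup.ext fun i => ?_
      fin_cases i
      · change ψ (τ (.of 0)) = pglClass (matN (h ^ 2)) * ψ (.of 0) * (pglClass (matN (h ^ 2)))⁻¹
        rw [hτ0, hψ0, eq_mul_inv_iff_mul_eq, ← pglClass_mul hA hN, ← pglClass_mul hN hA,
          matA_mul_matN, ← neg_one_smul ℂ, pglClass_smul (by norm_num)]
        rw [Matrix.det_mul]; exact mul_ne_zero hN hA
      · change ψ (τ (.of 1)) = pglClass (matN (h ^ 2)) * ψ (.of 1) * (pglClass (matN (h ^ 2)))⁻¹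
        have hNB : (matN (h ^ 2) * matB (h ^ 2)).det ≠ 0 := by
          rw [Matrix.det_mul]; exact mul_ne_zero hN hB
        have hAB : (matA (h ^ 2) * matB (h ^ 2)).det ≠ 0 := by
          rw [Matrix.det_mul]; exact mul_ne_zero hA hB
        have hANB : (matA (h ^ 2) * (matN (h ^ 2) * matB (h ^ 2))).det ≠ 0 := by
          rw [Matrix.det_mul]; exact mul_ne_zero hA hNB
        have e : pglClass (matA (h ^ 2)) * pglClass (matB (h ^ 2)) *
            (pglClass (matA (h ^ 2)) * (pglClass (matN (h ^ 2)) * pglClass (matB (h ^ 2)))) =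
              pglClass (matN (h ^ 2)) := by
          rw [← pglClass_mul hN hB, ← pglClass_mul hA hB, ← pglClass_mul hA hNB,
            ← pglClass_mul hAB hANB, matB_flip, pglClass_smul (by simp [h0]) hN]
        rw [hτ1, map_mul, map_mul, map_inv, map_inv, hψ0, hψ1, eq_mul_inv_iff_mul_eq]
        conv_lhs => rw [← e]
        simp only [mul_assoc, inv_mul_cancel_left]
        rw [← mul_assoc, ← sq, pglClass_matA_sq hq, one_mul]
  let r : Triangle 2 3 n ⋊[flip] ℤˣ := SemidirectProduct.inr (-1)
  let ι : Triangle 2 3 n →* Triangle 2 3 n ⋊[flip] ℤˣ := SemidirectProduct.inl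
  let Φ : Triangle 2 3 n ⋊[flip] ℤˣ →* PGL2 := SemidirectProduct.lift ψ ν hcompat
  let ρ : Triangle 2 3 n ⋊[flip] ℤˣ →* Module.End ℝ (Matrix (Fin 2) (Fin 2) ℂ) :=
    { toFun := fun w => ((w.right : ℤ) : ℝ) • conjPGL (Φ w)
      map_one' := by simp
      map_mul' := fun v w => by
        rw [map_mul, map_mul, SemidirectProduct.mul_right, Units.val_mul, Int.cast_mul,
          smul_mul_smul_comm] }
  let σ : Fin 3 → Triangle 2 3 n ⋊[flip] ℤˣ :=
    ![r, r * ι (.of 0),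
      ι (.of 0 * .of 1) * r]
  have hΦ : ∀ i, Φ (σ i) = pglClass (rootMat h i) := by
    intro i
    have hr : Φ (r) = pglClass (matN (h ^ 2)) := by
      simp only [r, Φ, SemidirectProduct.lift_inr, hν]
    fin_cases i
    · change Φ (r) = pglClass (h ^ 3 • matN (h ^ 2))
      rw [hr, pglClass_smul (pow_ne_zero _ h0) hN]
    · change Φ (r * ι (.of 0)) =
        pglClass (matN (h ^ 2) * matA (h ^ 2))
      rw [map_mul, hr, pglClass_mul hN hA, ← hψ0]
      simp only [ι, Φ, SemidirectProduct.lift_inl]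
    · change Φ (ι (.of 0 * .of 1) * r) =
        pglClass (h ^ 2 • (matU (h ^ 2) * matN (h ^ 2)))
      rw [pglClass_smul hq (by rw [Matrix.det_mul]; exact mul_ne_zero hU hN), map_mul, hr,
        pglClass_mul hU hN, ← pglClass_matA_mul_matB hq, ← hψ0, ← hψ1, ← map_mul]
      simp only [ι, Φ, SemidirectProduct.lift_inl]
  have hsign : ∀ i, (σ i).right = -1 := by
    intro i
    fin_cases i <;> simp [σ, r, ι]
  have hρσ : ∀ i X, ρ (σ i) X = -conjPGL (pglClass (rootMat h i)) X := by
    intro i X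
    change (((σ i).right : ℤ) : ℝ) • conjPGL (Φ (σ i)) X = _
    rw [hsign, hΦ]
    simp
  have hrr : (r * r :
      Triangle 2 3 n ⋊[flip] ℤˣ) = 1 := by simp only [r]; rw [← map_mul]; simp
  have hconj : ∀ x : Triangle 2 3 n, (r * ι x :
      Triangle 2 3 n ⋊[flip] ℤˣ) = ι (τ x) * r := by
    intro x
    have := SemidirectProduct.inl_aut (φ := flip) (-1) x
    rw [hflip] at this
    simp only [ι, r]
    rw [this, map_inv, inv_mul_cancel_right]
  have hinv : ∀ i, σ i * σ i = 1 := by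
    intro i
    fin_cases i
    · exact hrr
    · change (r * ι (.of 0)) *
        (r * ι (.of 0)) = 1
      nth_rewrite 1 [hconj]
      rw [hτ0, mul_assoc, ← mul_assoc (r), hrr, one_mul, ← map_mul, ← sq,
        ha, map_one]
    · change (ι (.of 0 * .of 1) * r) *
        (ι (.of 0 * .of 1) * r) = 1
      rw [mul_assoc, ← mul_assoc (r), hconj, mul_assoc, hrr, mul_one,
        ← map_mul, map_mul τ, hτ0, hτ1, mul_assoc (PresentedGroup.of 0) (PresentedGroup.of 1)⁻¹,
        mul_mul_of_sq ha, ← _root_.mul_inv_rev, mul_inv_cancel, map_one]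
  have h01 : (σ 0 * σ 1) ^ 2 = 1 := by
    change (r *
      (r * ι (.of 0))) ^ 2 = 1
    rw [← mul_assoc, hrr, one_mul, ← map_pow, ha, map_one]
  have h20 : (σ 2 * σ 0) ^ n = 1 := by
    change (ι (.of 0 * .of 1) * r *
      r) ^ n = 1
    rw [mul_assoc, hrr, mul_one, ← map_pow, hab, map_one]
  have h21 : (σ 2 * σ 1) ^ 3 = 1 := by
    change (ι (.of 0 * .of 1) * r *
      (r * ι (.of 0))) ^ 3 = 1
    have hb3 : (PresentedGroup.of 0 * PresentedGroup.of 1 * PresentedGroup.of 0 :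
        Triangle 2 3 n) ^ 3 = 1 := by
      nth_rewrite 2 [← inv_eq_of_mul_eq_one_left ((sq _).symm.trans ha)]
      rw [conj_pow, hb, mul_one, mul_inv_cancel]
    rw [mul_assoc, ← mul_assoc (r), hrr, one_mul, ← map_mul, ← map_pow,
      hb3, map_one]
  have hrel : ∀ i j, (σ i * σ j) ^ triangleMatrix n i j = 1 := by
    intro i j
    fin_cases i <;> fin_cases j
    · simpa [triangleMatrix] using hinv 0
    · exact h01
    · exact mul_pow_eq_one_symm (hinv _) (hinv _) h20
    · exact mul_pow_eq_one_symm (hinv _) (hinv _) h01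
    · simpa [triangleMatrix] using hinv 1
    · exact mul_pow_eq_one_symm (hinv _) (hinv _) h21
    · exact h20
    · exact h21
    · simpa [triangleMatrix] using hinv 2
  obtain ⟨f, hf⟩ := exists_pos_functional h0 (by rw [← pow_mul] at hD; exact hD)
  rw [injective_iff_map_eq_one]
  intro g hg
  have hρg : ρ (ι g) = 1 := by
    change (((ι g : Triangle 2 3 n ⋊[flip] ℤˣ).right : ℤ) : ℝ) •
      conjPGL (Φ (ι g)) = 1
    simp only [ι, Φ, SemidirectProduct.lift_inl, hg, map_one, SemidirectProduct.right_inl]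
    simp
  refine SemidirectProduct.inl_injective (φ := flip) ?_
  rw [map_one]
  refine eq_one_of_geometric_rep σ hinv (closure_triangle_reflections r rfl ι rfl) (triangleMatrix n) ?_ ?_ hrel
    ρ (rootMat h) ?_ ?_ f hf _ hρg
  · intro i j hij
    fin_cases i <;> fin_cases j <;> simp_all [triangleMatrix] <;> omega
  · intro i j
    fin_cases i <;> fin_cases j <;> rfl
  · intro i
    rw [hρσ, conjPGL_pglClass (hdet i) rfl]
  · intro i j hij
    have hac := rootMat_anticomm h0 hc i j hij
    rw [hρσ, conjPGL_pglClass (hdet i) (Y := -(rootMat h j +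
      (2 * Real.cos (Real.pi / triangleMatrix n i j)) • rootMat h i)) ?_, neg_neg]
    rw [neg_mul, add_mul, smul_mul_assoc, neg_add, ← hac]
    abel

end Extended

theorem exists_injective_triangleRep {n : ℕ} (hn : 7 ≤ n) {q : ℂ} (hq : IsPrimitiveRoot q n) :
    ∃ ψ : Triangle 2 3 n →* PGL2, ψ (.of 0) = pglClass (matA q) ∧
      ψ (.of 1) = pglClass (matB q) ∧ Function.Injective ψ := by
  obtain ⟨ψ, h0, h1⟩ := exists_triangleRep (by omega) hq
  have hn0 : (n : ℂ) ≠ 0 := by exact_mod_cast (by omega : n ≠ 0)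
  let h : ℂ := -Complex.exp (Real.pi / n * Complex.I)
  have hsq : h ^ 2 = Complex.exp (2 * Real.pi * Complex.I / n) := by
    simp only [h]
    rw [neg_sq, ← Complex.exp_nat_mul]
    congr 1
    push_cast
    ring
  have hprim : IsPrimitiveRoot (h ^ 2) n := hsq ▸ Complex.isPrimitiveRoot_exp n (by omega)
  have hc : ((2 * Real.cos (Real.pi / n) : ℝ) : ℂ) * h = -(h ^ 2 + 1) := by
    have e : Complex.exp (-(Real.pi / n) * Complex.I) * Complex.exp (Real.pi / n * Complex.I) = 1 := by
      rw [← Complex.exp_add]; simp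
    push_cast
    rw [Complex.two_cos]
    simp only [h]
    linear_combination -e
  obtain ⟨ψ', h0', h1'⟩ := exists_triangleRep (by omega) hprim
  exact ⟨ψ, h0, h1, injective_of_isPrimitiveRoot (by omega) hq hprim ψ ψ' h0 h1 h0' h1'
    (injective_triangleRep hn hc hprim ψ' h0' h1')⟩

/-- For `k ≥ 3`, `0 < m < 2k+1`, `gcd(m,2k+1) = 1` and `q = exp(±2mπi/(2k+1))`,
the homomorphism from the presented group
`⟨x, y | x^(2k+1) = y^(2k+1) = (xy)^(2k+1) = 1, (x⁻¹y^k)² = 1, (y^k x^(k−1))³ = 1⟩`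
to `PGL(2,ℂ)` sending `x ↦ [A(q)]`, `y ↦ [B(q)]` is injective with image `Γ(q)`;
in particular `Γ(q)` is isomorphic to the triangle group `Δ(2,3,2k+1)`. -/
theorem stmt1 (k m : ℕ) (hk : 3 ≤ k) (hm0 : 0 < m) (hmk : m < 2 * k + 1)
    (hgcd : Nat.gcd m (2 * k + 1) = 1) (q : ℂ)
    (hq : q = Complex.exp (2 * (m : ℂ) * (Real.pi : ℂ) * Complex.I / ((2 * k + 1 : ℕ) : ℂ)) ∨
          q = Complex.exp (-(2 * (m : ℂ) * (Real.pi : ℂ) * Complex.I) / ((2 * k + 1 : ℕ) : ℂ))) :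
    (∃ φ : PresentedGroup (oddRels k) →* PGL2,
      φ (PresentedGroup.of 0) = Apr q ∧
      φ (PresentedGroup.of 1) = Bpr q ∧
      Function.Injective φ ∧
      φ.range = Gamma q) ∧
    Nonempty (↥(Gamma q) ≃* Triangle 2 3 (2 * k + 1)) := by
  have hprim : IsPrimitiveRoot q (2 * k + 1) := by
    have h := Complex.isPrimitiveRoot_exp_of_coprime m (2 * k + 1) (by omega) hgcd
    rcases hq with rfl | rfl
    · convert h using 2
      ring
    · have e : Complex.exp (-(2 * (m : ℂ) * (Real.pi : ℂ) * Complex.I) / ((2 * k + 1 : ℕ) : ℂ)) =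
          (Complex.exp (2 * Real.pi * Complex.I * (m / ((2 * k + 1 : ℕ) : ℂ))))⁻¹ := by
        rw [← Complex.exp_neg]
        congr 1
        ring
      rw [e]
      exact h.inv
  have hq0 : q ≠ 0 := hprim.ne_zero (by omega)
  obtain ⟨ψ, h0, h1, hinj⟩ := exists_injective_triangleRep (by omega) hprim
  obtain ⟨e, he0, he1⟩ := exists_oddEquivTriangle k (by omega)
  let φ : PresentedGroup (oddRels k) →* PGL2 := ψ.comp e.toMonoidHom
  have hφ0 : φ (PresentedGroup.of 0) = Apr q := by
    change ψ (e (.of 0)) = _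
    rw [he0, map_pow, map_inv, map_mul, h0, h1, pglClass_matA_mul_matB hq0,
      inv_pglClass_matU_sq hq0]
  have hφ1 : φ (PresentedGroup.of 1) = Bpr q := by
    change ψ (e (.of 1)) = _
    rw [he1, map_mul, map_mul, map_inv, map_pow, map_inv, map_mul, h0, h1,
      pglClass_matA_mul_matB hq0, inv_pglClass_matU_sq hq0, pglClass_matB_conj_Apr hq0]
  have hφ : Function.Injective φ := hinj.comp e.injective
  have hrange : φ.range = Gamma q := by
    rw [MonoidHom.range_eq_map, ← PresentedGroup.closure_range_of, MonoidHom.map_closure, Gamma]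
    congr 1
    ext x
    simp [Fin.exists_fin_two, hφ0, hφ1, eq_comm]
  exact ⟨⟨φ, hφ0, hφ1, hφ, hrange⟩,
    ⟨((MulEquiv.subgroupCongr hrange.symm).trans (MonoidHom.ofInjective hφ).symm).trans e⟩⟩
end

section
/- Let n = 2k be even with n ≠ 6, and let q be a primitive n-th root of unity. Let φ : F₂ → PGL(2,ℂ) be the homomorphism from the free group F₂ on two generators x, y defined by φ(x) = [A(q)] and φ(y) = [B(q)]. Then the kernel of φ is the normal closure in F₂ of the set {x^k, y^k, (xy)^k}. -/
open Matrix

section Tits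

variable {B : Type*} {W : Type*} [Group W] {M : CoxeterMatrix B}

/-- If `j` but not `i` is a right descent of `w`, then `w` factors as a strictly shorter element
with neither `i` nor `j` as a right descent, times an alternating word of length less
than `M i j`. -/
theorem exists_minimal_dihedral_factor (cs : CoxeterSystem M W) {i j : B} (h2 : 2 ≤ M i j)
    {w : W} (hi : ¬ cs.IsRightDescent w i) (hj : cs.IsRightDescent w j) :
    ∃ (v : W) (m : ℕ), m < M i j ∧ cs.length v < cs.length w ∧
      w = v * cs.wordProd (CoxeterSystem.alternatingWord i j m) ∧
      ¬ cs.IsRightDescent v i ∧ ¬ cs.IsRightDescent v j := by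
  let P : ℕ → Prop := fun m => ∃ v, cs.length v + m = cs.length w ∧
    w = v * cs.wordProd (CoxeterSystem.alternatingWord i j m)
  classical
  have hP1 : P 1 := ⟨w * cs.simple j, cs.isRightDescent_iff.1 hj, by
    simp [CoxeterSystem.alternatingWord]⟩
  have h1w : 1 ≤ cs.length w := by have := cs.isRightDescent_iff.1 hj; omega
  set m := Nat.findGreatest P (cs.length w) with hmdef
  have hPm : P m := Nat.findGreatest_spec h1w hP1
  have hm1 : 1 ≤ m := Nat.le_findGreatest h1w hP1
  have hmax : ¬ P (m + 1) := fun h => by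
    have hle : m + 1 ≤ cs.length w := by obtain ⟨v, hv, -⟩ := h; omega
    have := Nat.le_findGreatest hle h
    omega
  obtain ⟨v, hv, hw⟩ := hPm
  have hnext : ¬ cs.IsRightDescent v (if Even m then j else i) := fun h => by
    rw [cs.isRightDescent_iff] at h
    refine hmax ⟨v * cs.simple (if Even m then j else i), by omega, ?_⟩
    rw [CoxeterSystem.alternatingWord_succ', cs.wordProd_cons, ← mul_assoc,
      cs.simple_mul_simple_cancel_right]
    exact hw
  have hfirst : ¬ cs.IsRightDescent v (if Even m then i else j) := fun h => by
    rw [cs.isRightDescent_iff] at h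
    obtain ⟨r, hr⟩ : ∃ r, m = r + 1 := ⟨m - 1, by omega⟩
    have hlet : (if Even m then i else j) = if Even r then j else i := by
      rw [hr]; by_cases he : Even r <;> simp [Nat.even_add_one, he]
    rw [hlet] at h
    have hw' : w = v * cs.simple (if Even r then j else i) *
        cs.wordProd (CoxeterSystem.alternatingWord i j r) := by
      rw [hw, hr, CoxeterSystem.alternatingWord_succ', cs.wordProd_cons, mul_assoc]
    have h3 := cs.length_mul_le (v * cs.simple (if Even r then j else i))
      (cs.wordProd (CoxeterSystem.alternatingWord i j r))
    have h4 := cs.length_wordProd_le (CoxeterSystem.alternatingWord i j r)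
    rw [← hw'] at h3
    rw [CoxeterSystem.length_alternatingWord] at h4
    omega
  refine ⟨v, m, ?_, by omega, hw, ?_, ?_⟩
  · by_contra hge
    push Not at hge
    have hsplit : ∀ r, M i j ≤ r → ∃ u : W, cs.length u + 1 ≤ r ∧
        cs.wordProd (CoxeterSystem.alternatingWord i j r) = u * cs.simple i := by
      intro r hr
      induction r, hr using Nat.le_induction with
      | base =>
        refine ⟨cs.wordProd (CoxeterSystem.alternatingWord i j (M i j - 1)), ?_, ?_⟩
        · have := cs.length_wordProd_le (CoxeterSystem.alternatingWord i j (M i j - 1))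
          rw [CoxeterSystem.length_alternatingWord] at this
          omega
        · have := cs.wordProd_braidWord_eq i j
          unfold CoxeterSystem.braidWord at this
          rw [this, M.symmetric j i]
          obtain ⟨r, hr⟩ : ∃ r, M i j = r + 1 := ⟨M i j - 1, by omega⟩
          rw [hr, CoxeterSystem.alternatingWord_succ, cs.wordProd_concat]
          simp
      | succ r hr ih =>
        obtain ⟨u, hu, hu'⟩ := ih
        refine ⟨cs.simple (if Even r then j else i) * u, ?_, ?_⟩
        · have := cs.length_mul_le (cs.simple (if Even r then j else i)) u
          rw [cs.length_simple] at this
          omega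
        · rw [CoxeterSystem.alternatingWord_succ', cs.wordProd_cons, hu', mul_assoc]
    obtain ⟨u, hu, hu'⟩ := hsplit m hge
    apply hi
    rw [CoxeterSystem.IsRightDescent, hw, hu', ← mul_assoc, cs.simple_mul_simple_cancel_right,
      mul_assoc, ← hu', ← hw]
    have := cs.length_mul_le v u
    omega
  · by_cases he : Even m
    · simpa [he] using hfirst
    · simpa [he] using hnext
  · by_cases he : Even m
    · simpa [he] using hnext
    · simpa [he] using hfirst

variable [DecidableEq B]

/-- The alternating products of two simple reflections, in the representation `ρ`, move the simple
root `α_i` inside the plane spanned by `α_i` and `α_j`, with explicit sine coefficients. -/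
theorem smul_rho_alternatingWord (cs : CoxeterSystem M W) (ρ : W →* Module.End ℝ (B → ℝ))
    (hneg : ∀ i, ρ (cs.simple i) (Pi.single i 1) = -Pi.single i 1)
    {i j : B} {θ : ℝ}
    (hi : ρ (cs.simple i) (Pi.single j 1) = Pi.single j 1 + (2 * Real.cos θ) • Pi.single i 1)
    (hj : ρ (cs.simple j) (Pi.single i 1) = Pi.single i 1 + (2 * Real.cos θ) • Pi.single j 1)
    (m : ℕ) :
    Real.sin θ • ρ (cs.wordProd (CoxeterSystem.alternatingWord i j m)) (Pi.single i 1) =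
      Real.sin ((if Even m then m + 1 else m : ℕ) * θ) • Pi.single i 1 +
        Real.sin ((if Even m then m else m + 1 : ℕ) * θ) • Pi.single j 1 := by
  induction m with
  | zero => simp [CoxeterSystem.alternatingWord]
  | succ m ih =>
    have key : Real.sin (((m + 1 + 1 : ℕ) : ℝ) * θ) =
        2 * Real.cos θ * Real.sin (((m + 1 : ℕ) : ℝ) * θ) - Real.sin (m * θ) := by
      have h1 : ((m + 1 + 1 : ℕ) : ℝ) * θ = ((m + 1 : ℕ) : ℝ) * θ + θ := by push_cast; ring
      have h2 : (m : ℝ) * θ = ((m + 1 : ℕ) : ℝ) * θ - θ := by push_cast; ring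
      rw [h1, h2, Real.sin_add, Real.sin_sub]; ring
    rw [CoxeterSystem.alternatingWord_succ', cs.wordProd_cons, map_mul, Module.End.mul_apply,
      ← map_smul, ih]
    by_cases h : Even m
    · have h' : ¬ Even (m + 1) := by simpa [Nat.even_add_one] using h
      simp only [h, h', if_true, if_false, map_add, map_smul, hneg, hj, key]
      module
    · have h' : Even (m + 1) := by simpa [Nat.even_add_one] using h
      simp only [h, h', if_true, if_false, map_add, map_smul, hneg, hi, key]
      module

theorem rho_alternatingWord_nonneg (cs : CoxeterSystem M W) (ρ : W →* Module.End ℝ (B → ℝ))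
    (hneg : ∀ i, ρ (cs.simple i) (Pi.single i 1) = -Pi.single i 1)
    (hadd : ∀ i j, i ≠ j → ρ (cs.simple i) (Pi.single j 1) =
      Pi.single j 1 + (2 * Real.cos (Real.pi / M i j)) • Pi.single i 1)
    {i j : B} (hij : i ≠ j) (h2 : 2 ≤ M i j) {m : ℕ} (hm : m < M i j) :
    ∃ a b : ℝ, 0 ≤ a ∧ 0 ≤ b ∧
      ρ (cs.wordProd (CoxeterSystem.alternatingWord i j m)) (Pi.single i 1) =
        a • Pi.single i 1 + b • Pi.single j 1 := by
  set θ : ℝ := Real.pi / M i j with hθ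
  have hM : (0 : ℝ) < M i j := by exact_mod_cast (by omega : 0 < M i j)
  have hpos : 0 < θ := div_pos Real.pi_pos hM
  have hle : ∀ r : ℕ, r ≤ M i j → 0 ≤ Real.sin (r * θ) := by
    intro r hr
    apply Real.sin_nonneg_of_nonneg_of_le_pi (by positivity)
    have : (r : ℝ) ≤ M i j := by exact_mod_cast hr
    calc (r : ℝ) * θ ≤ M i j * θ := by gcongr
      _ = Real.pi := by rw [hθ]; field_simp
  have hs : 0 < Real.sin θ := by
    apply Real.sin_pos_of_pos_of_lt_pi hpos
    rw [hθ, div_lt_iff₀ hM]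
    have : (2 : ℝ) ≤ M i j := by exact_mod_cast h2
    nlinarith [Real.pi_pos]
  have key := smul_rho_alternatingWord cs ρ hneg (hadd i j hij)
    (by simpa only [M.symmetric j i] using! hadd j i hij.symm) m
  refine ⟨(Real.sin θ)⁻¹ * Real.sin ((if Even m then m + 1 else m : ℕ) * θ),
    (Real.sin θ)⁻¹ * Real.sin ((if Even m then m else m + 1 : ℕ) * θ),
    mul_nonneg (by positivity) (hle _ (by split_ifs <;> omega)),
    mul_nonneg (by positivity) (hle _ (by split_ifs <;> omega)), ?_⟩
  rw [mul_smul, mul_smul, ← smul_add, ← key, smul_smul, inv_mul_cancel₀ hs.ne', one_smul]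

theorem rho_single_nonneg (cs : CoxeterSystem M W) (ρ : W →* Module.End ℝ (B → ℝ))
    (hM : ∀ i j, i ≠ j → 2 ≤ M i j)
    (hneg : ∀ i, ρ (cs.simple i) (Pi.single i 1) = -Pi.single i 1)
    (hadd : ∀ i j, i ≠ j → ρ (cs.simple i) (Pi.single j 1) =
      Pi.single j 1 + (2 * Real.cos (Real.pi / M i j)) • Pi.single i 1)
    (w : W) (i : B) (hi : ¬ cs.IsRightDescent w i) : 0 ≤ ρ w (Pi.single i 1) := by
  induction hn : cs.length w using Nat.strong_induction_on generalizing w i with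
  | _ n ih =>
    subst hn
    by_cases hw : w = 1
    · simp [hw]
    obtain ⟨j, hj⟩ := cs.exists_rightDescent_of_ne_one hw
    have hij : i ≠ j := by rintro rfl; exact hi hj
    obtain ⟨v, m, hm, hlt, hwv, hvi, hvj⟩ := exists_minimal_dihedral_factor cs (hM i j hij) hi hj
    obtain ⟨a, b, ha, hb, hab⟩ := rho_alternatingWord_nonneg cs ρ hneg hadd hij (hM i j hij) hm
    rw [hwv, map_mul, Module.End.mul_apply, hab, map_add, map_smul, map_smul]
    exact add_nonneg (smul_nonneg ha (ih _ hlt v i hvi rfl))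
      (smul_nonneg hb (ih _ hlt v j hvj rfl))

/-- **Tits' theorem**: the geometric representation of a Coxeter group is faithful. -/
theorem rho_injective (cs : CoxeterSystem M W) (ρ : W →* Module.End ℝ (B → ℝ))
    (hM : ∀ i j, i ≠ j → 2 ≤ M i j)
    (hneg : ∀ i, ρ (cs.simple i) (Pi.single i 1) = -Pi.single i 1)
    (hadd : ∀ i j, i ≠ j → ρ (cs.simple i) (Pi.single j 1) =
      Pi.single j 1 + (2 * Real.cos (Real.pi / M i j)) • Pi.single i 1) :
    Function.Injective ρ := by
  rw [injective_iff_map_eq_one]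
  intro w hw
  by_contra hne
  obtain ⟨i, hi⟩ := cs.exists_rightDescent_of_ne_one hne
  have h := rho_single_nonneg cs ρ hM hneg hadd (w * cs.simple i) i
    (cs.isRightDescent_iff_not_isRightDescent_mul.1 hi)
  rw [map_mul, hw, one_mul, hneg] at h
  have := h i
  simp at this
  linarith

end Tits

section EqualLabels

variable {B : Type*} [Fintype B] [DecidableEq B]

/-- The linear reflection `v ↦ v - 2⟨v, α_i⟩ α_i`, for the symmetric form on `B → ℝ` with
`⟨α_i, α_i⟩ = 1` and `⟨α_i, α_j⟩ = -c / 2` for `i ≠ j`, where `α_i = Pi.single i 1`. -/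
noncomputable def equiReflection (c : ℝ) (i : B) : Module.End ℝ (B → ℝ) :=
  LinearMap.id + (∑ j, (if j = i then (-2 : ℝ) else c) •
    (LinearMap.proj j : (B → ℝ) →ₗ[ℝ] ℝ)).smulRight (Pi.single i 1)

theorem equiReflection_apply (c : ℝ) (i : B) (v : B → ℝ) :
    equiReflection c i v =
      v + (∑ j, (if j = i then (-2 : ℝ) else c) * v j) • Pi.single i (1 : ℝ) := by
  simp [equiReflection, LinearMap.sum_apply, -neg_mul, -ite_mul, -ite_smul]

theorem equiReflection_single_self (c : ℝ) (i : B) :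
    equiReflection c i (Pi.single i 1) = -Pi.single i 1 := by
  simp only [equiReflection_apply, Pi.single_apply, mul_ite, mul_one, mul_zero,
    Finset.sum_ite_eq', Finset.mem_univ, if_true]
  module

theorem equiReflection_single_of_ne (c : ℝ) {i j : B} (h : i ≠ j) :
    equiReflection c i (Pi.single j 1) = Pi.single j 1 + c • Pi.single i 1 := by
  simp [equiReflection_apply, Pi.single_apply, h.symm]

theorem equiReflection_mul_self (c : ℝ) (i : B) : equiReflection c i * equiReflection c i = 1 := by
  refine LinearMap.pi_ext' fun j => LinearMap.ext_ring ?_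
  by_cases h : i = j
  · subst h
    simp [equiReflection_single_self]
  · simp [equiReflection_single_self, equiReflection_single_of_ne c h]

theorem sin_smul_equiReflection_mul_pow {θ : ℝ} {i j : B} (h : i ≠ j) (r : ℕ) :
    Real.sin θ • ((equiReflection (2 * Real.cos θ) i * equiReflection (2 * Real.cos θ) j) ^ r)
        (Pi.single i (1 : ℝ)) =
      Real.sin ((2 * r + 1) * θ) • Pi.single i 1 + Real.sin (2 * r * θ) • Pi.single j 1 ∧
    Real.sin θ • ((equiReflection (2 * Real.cos θ) i * equiReflection (2 * Real.cos θ) j) ^ r)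
        (Pi.single j (1 : ℝ)) =
      -Real.sin (2 * r * θ) • Pi.single i 1 - Real.sin ((2 * r - 1) * θ) • Pi.single j 1 := by
  induction r with
  | zero => simp
  | succ r ih =>
    have e1 : (2 * ((r + 1 : ℕ) : ℝ) + 1) * θ = 2 * r * θ + 3 * θ := by push_cast; ring
    have e2 : 2 * ((r + 1 : ℕ) : ℝ) * θ = 2 * r * θ + 2 * θ := by push_cast; ring
    have e3 : (2 * ((r + 1 : ℕ) : ℝ) - 1) * θ = 2 * r * θ + θ := by push_cast; ring
    have e4 : (2 * (r : ℝ) + 1) * θ = 2 * r * θ + θ := by ring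
    have e5 : (2 * (r : ℝ) - 1) * θ = 2 * r * θ - θ := by ring
    rw [e4, e5] at ih
    have hs : Real.sin θ ^ 3 = Real.sin θ * (1 - Real.cos θ ^ 2) := by
      rw [← Real.sin_sq]; ring
    rw [e1, e2, e3, pow_succ', Module.End.mul_apply, Module.End.mul_apply _ _ (Pi.single j 1)]
    constructor
    · rw [← map_smul, ih.1]
      simp only [Module.End.mul_apply, map_add, map_smul, equiReflection_single_self,
        equiReflection_single_of_ne _ h, equiReflection_single_of_ne _ h.symm, map_neg,
        Real.sin_add, Real.sin_two_mul, Real.cos_two_mul, Real.sin_three_mul, Real.cos_three_mul,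
        hs]
      module
    · rw [← map_smul, ih.2]
      simp only [Module.End.mul_apply, map_add, map_sub, map_smul, equiReflection_single_self,
        equiReflection_single_of_ne _ h, equiReflection_single_of_ne _ h.symm, map_neg,
        Real.sin_add, Real.sin_sub, Real.sin_two_mul, Real.cos_two_mul]
      module

theorem equiReflection_mul_pow {k : ℕ} (hk : 2 ≤ k) {i j : B} (h : i ≠ j) :
    (equiReflection (2 * Real.cos (Real.pi / k)) i *
      equiReflection (2 * Real.cos (Real.pi / k)) j) ^ k = 1 := by
  have hk0 : (0 : ℝ) < k := by positivity
  have hk2 : (2 : ℝ) ≤ k := by exact_mod_cast hk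
  set θ : ℝ := Real.pi / k with hθ
  have hkθ : k * θ = Real.pi := by rw [hθ]; field_simp
  have hpos : 0 < θ := div_pos Real.pi_pos hk0
  have hlt : θ < Real.pi := by
    rw [hθ, div_lt_iff₀ hk0]
    nlinarith [Real.pi_pos]
  have hs : Real.sin θ ≠ 0 := (Real.sin_pos_of_pos_of_lt_pi hpos hlt).ne'
  obtain ⟨hi, hj⟩ := sin_smul_equiReflection_mul_pow (θ := θ) h k
  have e1 : (2 * (k : ℝ) + 1) * θ = θ + 2 * Real.pi := by rw [← hkθ]; ring
  have e2 : 2 * (k : ℝ) * θ = 2 * Real.pi := by rw [← hkθ]; ring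
  have e3 : (2 * (k : ℝ) - 1) * θ = -θ + 2 * Real.pi := by rw [← hkθ]; ring
  rw [e1, e2, Real.sin_add_two_pi, Real.sin_two_pi, zero_smul, add_zero] at hi
  rw [e2, e3, Real.sin_add_two_pi, Real.sin_two_pi, neg_zero, zero_smul, Real.sin_neg, neg_smul,
    zero_sub, neg_neg] at hj
  replace hi := smul_right_injective _ hs hi
  replace hj := smul_right_injective _ hs hj
  refine LinearMap.pi_ext' fun l => LinearMap.ext_ring ?_
  simp only [LinearMap.comp_apply, LinearMap.single_apply, Module.End.one_apply]
  by_cases hil : i = l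
  · rw [← hil, hi]
  by_cases hjl : j = l
  · rw [← hjl, hj]
  have hc : 2 - 2 * Real.cos θ ≠ 0 := by
    have h1 := Real.sin_sq_add_cos_sq θ
    intro h0
    have h2 : Real.cos θ = 1 := by linarith
    rw [h2] at h1
    exact hs (by nlinarith)
  set c := 2 * Real.cos θ with hcdef
  have hfix : ∀ r : ℕ, ((equiReflection c i * equiReflection c j) ^ r)
      (Pi.single l (1 : ℝ) + (c / (2 - c)) • (Pi.single i 1 + Pi.single j 1)) =
      Pi.single l (1 : ℝ) + (c / (2 - c)) • (Pi.single i 1 + Pi.single j 1) := by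
    intro r
    have hb : c - c / (2 - c) + c / (2 - c) * c = c / (2 - c) := by field_simp; ring
    have h1 : equiReflection c i
        (Pi.single l (1 : ℝ) + (c / (2 - c)) • (Pi.single i 1 + Pi.single j 1)) =
        Pi.single l (1 : ℝ) + (c / (2 - c)) • (Pi.single i 1 + Pi.single j 1) := by
      simp only [map_add, map_smul, equiReflection_single_self, equiReflection_single_of_ne _ h,
        equiReflection_single_of_ne _ hil]
      linear_combination (norm := module) hb • (Pi.single i 1 : B → ℝ)
    have h2 : equiReflection c j
        (Pi.single l (1 : ℝ) + (c / (2 - c)) • (Pi.single i 1 + Pi.single j 1)) =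
        Pi.single l (1 : ℝ) + (c / (2 - c)) • (Pi.single i 1 + Pi.single j 1) := by
      simp only [map_add, map_smul, equiReflection_single_self, equiReflection_single_of_ne _ h.symm,
        equiReflection_single_of_ne _ hjl]
      linear_combination (norm := module) hb • (Pi.single j 1 : B → ℝ)
    induction r with
    | zero => simp
    | succ r ih => rw [pow_succ', Module.End.mul_apply, ih, Module.End.mul_apply, h2, h1]
  have := hfix k
  rw [map_add, map_smul, map_add, hi, hj] at this
  exact add_right_cancel this

/-- The Coxeter matrix all of whose off-diagonal entries are equal to `k`. -/
def equiCoxeterMatrix (B : Type*) [DecidableEq B] (k : ℕ) (hk : 2 ≤ k) : CoxeterMatrix B where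
  M := Matrix.of fun i j => if i = j then 1 else k
  isSymm := by
    ext i j
    simp [eq_comm]
  diagonal i := by simp
  off_diagonal i j h := by
    simp only [Matrix.of_apply, h, if_false]
    omega

end EqualLabels

section Burau

/-- The homomorphism `F₂ → GL(2,ℂ)` sending the generators to `A(q)` and `B(q)`. -/
noncomputable def burauHom (q : ℂ) : FreeGroup (Fin 2) →* GL (Fin 2) ℂ :=
  FreeGroup.lift ![AGL q, BGL q]

theorem coe_AGL {q : ℂ} (hq : q ≠ 0) :
    (AGL q : Matrix (Fin 2) (Fin 2) ℂ) = !![q ^ 2, 1 + q; 0, 1] := by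
  rw [AGL, dif_neg hq]; rfl

theorem coe_BGL {q : ℂ} (hq : q ≠ 0) :
    (BGL q : Matrix (Fin 2) (Fin 2) ℂ) = !![1, 0; -q - q ^ 2, q ^ 2] := by
  rw [BGL, dif_neg hq]; rfl

theorem mem_center_iff_entries {F : Type*} [Field F] (g : GL (Fin 2) F) :
    g ∈ Subgroup.center (GL (Fin 2) F) ↔ g.val 0 1 = 0 ∧ g.val 1 0 = 0 ∧ g.val 0 0 = g.val 1 1 := by
  rw [Matrix.GeneralLinearGroup.mem_center_iff_val_mem_range_scalar]
  constructor
  · rintro ⟨a, ha⟩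
    rw [← ha]
    simp
  · rintro ⟨h1, h2, h3⟩
    refine ⟨g.val 0 0, ?_⟩
    ext i j
    fin_cases i <;> fin_cases j <;> simp [h1, h2, h3]

/-- Whether the image of a word is central depends only on the Galois orbit of `q`. -/
theorem burauHom_mem_center_of_isPrimitiveRoot {n : ℕ} (hn : 0 < n) {q q' : ℂ}
    (hq : IsPrimitiveRoot q n) (hq' : IsPrimitiveRoot q' n) {w : FreeGroup (Fin 2)}
    (hw : burauHom q w ∈ Subgroup.center (GL (Fin 2) ℂ)) :
    burauHom q' w ∈ Subgroup.center (GL (Fin 2) ℂ) := by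
  have : NeZero n := ⟨hn.ne'⟩
  have : NeZero (n : ℚ) := ⟨by exact_mod_cast hn.ne'⟩
  have : IsCyclotomicExtension {n} ℚ (CyclotomicField n ℚ) :=
    CyclotomicField.isCyclotomicExtension n ℚ
  have hirr := Polynomial.cyclotomic.irreducible_rat hn
  have hζ := IsCyclotomicExtension.zeta_spec n ℚ (CyclotomicField n ℚ)
  set ζ := IsCyclotomicExtension.zeta n ℚ (CyclotomicField n ℚ)
  have hζ0 : ζ ≠ 0 := hζ.ne_zero hn.ne'
  let A : GL (Fin 2) (CyclotomicField n ℚ) :=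
    Matrix.GeneralLinearGroup.mkOfDetNeZero !![ζ ^ 2, 1 + ζ; 0, 1]
      (by rw [Matrix.det_fin_two_of]; simpa using hζ0)
  let B : GL (Fin 2) (CyclotomicField n ℚ) :=
    Matrix.GeneralLinearGroup.mkOfDetNeZero !![1, 0; -ζ - ζ ^ 2, ζ ^ 2]
      (by rw [Matrix.det_fin_two_of]; simpa using hζ0)
  have hmap : ∀ p : ℂ, IsPrimitiveRoot p n → ∃ σ : CyclotomicField n ℚ →+* ℂ,
      burauHom p = (Matrix.GeneralLinearGroup.map σ).comp (FreeGroup.lift ![A, B]) := by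
    intro p hp
    have hp0 : p ≠ 0 := hp.ne_zero hn.ne'
    let σ := (hζ.embeddingsEquivPrimitiveRoots ℂ hirr).symm
      ⟨p, (mem_primitiveRoots hn).2 hp⟩
    have hσ : σ ζ = p := by
      rw [← hζ.embeddingsEquivPrimitiveRoots_apply_coe ℂ hirr σ, Equiv.apply_symm_apply]
    refine ⟨σ, ?_⟩
    ext i a b
    fin_cases i
    · fin_cases a <;> fin_cases b <;>
        simp [burauHom, coe_AGL hp0, A, Matrix.GeneralLinearGroup.mkOfDetNeZero, hσ]
    · fin_cases a <;> fin_cases b <;>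
        simp [burauHom, coe_BGL hp0, B, Matrix.GeneralLinearGroup.mkOfDetNeZero, hσ]
  obtain ⟨σ, hσ⟩ := hmap q hq
  obtain ⟨σ', hσ'⟩ := hmap q' hq'
  rw [hσ, mem_center_iff_entries] at hw
  rw [hσ']
  refine Matrix.GeneralLinearGroup.map_center_le σ' ((mem_center_iff_entries _).2 ?_)
  simpa only [MonoidHom.comp_apply, Matrix.GeneralLinearGroup.map_apply, map_eq_zero,
    σ.injective.eq_iff] using hw

theorem AGL_pow_mem_center {k : ℕ} (hk : 0 < k) {q : ℂ} (hq : IsPrimitiveRoot q (2 * k)) :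
    AGL q ^ k ∈ Subgroup.center (GL (Fin 2) ℂ) := by
  have hq0 : q ≠ 0 := hq.ne_zero (by omega)
  have hq1 : q ≠ 1 := hq.ne_one (by omega)
  have hqk : q ^ (2 * k) = 1 := hq.pow_eq_one
  have key : ∀ m : ℕ, ((1 - q) • (AGL q : Matrix (Fin 2) (Fin 2) ℂ) ^ m) =
      !![(1 - q) * q ^ (2 * m), 1 - q ^ (2 * m); 0, 1 - q] := by
    intro m
    induction m with
    | zero => ext i j; fin_cases i <;> fin_cases j <;> simp
    | succ m ih =>
      rw [pow_succ, ← smul_mul_assoc, ih, coe_AGL hq0]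
      ext i j
      fin_cases i <;> fin_cases j <;> simp [Matrix.mul_apply, Fin.sum_univ_two] <;> ring
  have h := key k
  have h1 : (1 - q) ≠ 0 := sub_ne_zero.2 hq1.symm
  have h' : (AGL q : Matrix (Fin 2) (Fin 2) ℂ) ^ k = 1 := by
    apply smul_right_injective _ h1
    simp only [h, hqk]
    ext i j
    fin_cases i <;> fin_cases j <;> simp
  rw [mem_center_iff_entries, Units.val_pow_eq_pow_val, h']
  simp

theorem BGL_pow_mem_center {k : ℕ} (hk : 0 < k) {q : ℂ} (hq : IsPrimitiveRoot q (2 * k)) :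
    BGL q ^ k ∈ Subgroup.center (GL (Fin 2) ℂ) := by
  have hq0 : q ≠ 0 := hq.ne_zero (by omega)
  have hq1 : q ≠ 1 := hq.ne_one (by omega)
  have hqk : q ^ (2 * k) = 1 := hq.pow_eq_one
  have key : ∀ m : ℕ, ((1 - q) • (BGL q : Matrix (Fin 2) (Fin 2) ℂ) ^ m) =
      !![1 - q, 0; -q * (1 - q ^ (2 * m)), (1 - q) * q ^ (2 * m)] := by
    intro m
    induction m with
    | zero => ext i j; fin_cases i <;> fin_cases j <;> simp
    | succ m ih =>
      rw [pow_succ, ← smul_mul_assoc, ih, coe_BGL hq0]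
      ext i j
      fin_cases i <;> fin_cases j <;> simp [Matrix.mul_apply, Fin.sum_univ_two] <;> ring
  have h := key k
  have h1 : (1 - q) ≠ 0 := sub_ne_zero.2 hq1.symm
  have h' : (BGL q : Matrix (Fin 2) (Fin 2) ℂ) ^ k = 1 := by
    apply smul_right_injective _ h1
    simp only [h, hqk]
    ext i j
    fin_cases i <;> fin_cases j <;> simp
  rw [mem_center_iff_entries, Units.val_pow_eq_pow_val, h']
  simp

theorem AGL_mul_BGL_pow_mem_center {k : ℕ} (hk : 0 < k) {q : ℂ} (hq : IsPrimitiveRoot q (2 * k)) :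
    (AGL q * BGL q) ^ k ∈ Subgroup.center (GL (Fin 2) ℂ) := by
  have hq0 : q ≠ 0 := hq.ne_zero (by omega)
  have hqk : q ^ (2 * k) = 1 := hq.pow_eq_one
  by_cases hk1 : k = 1
  · subst hk1
    rw [pow_one]
    exact mul_mem (by simpa using AGL_pow_mem_center hk hq) (by simpa using BGL_pow_mem_center hk hq)
  have hne : q ^ 3 - q ≠ 0 := by
    have h2 : q ^ 2 ≠ 1 := hq.pow_ne_one_of_pos_of_lt (by norm_num) (by omega)
    have : q ^ 3 - q = q * (q ^ 2 - 1) := by ring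
    rw [this]
    exact mul_ne_zero hq0 (sub_ne_zero.2 h2)
  obtain ⟨N, hN⟩ : ∃ N, N = (AGL q : Matrix (Fin 2) (Fin 2) ℂ) * BGL q := ⟨_, rfl⟩
  have hNe : N = !![q ^ 2 - q * (1 + q) ^ 2, (1 + q) * q ^ 2; -q - q ^ 2, q ^ 2] := by
    rw [hN, coe_AGL hq0, coe_BGL hq0]
    ext i j
    fin_cases i <;> fin_cases j <;> simp [Matrix.mul_apply, Fin.sum_univ_two] <;> ring
  have hCH : N * N = (-(q + q ^ 3)) • N - q ^ 4 • (1 : Matrix (Fin 2) (Fin 2) ℂ) := by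
    rw [hNe]
    ext i j
    fin_cases i <;> fin_cases j <;> simp [Matrix.mul_apply, Fin.sum_univ_two] <;> ring
  have key : ∀ m : ℕ, (q ^ 3 - q) • N ^ m =
      ((-q) ^ m - (-q ^ 3) ^ m) • N +
        (q ^ 3 * (-q) ^ m - q * (-q ^ 3) ^ m) • (1 : Matrix (Fin 2) (Fin 2) ℂ) := by
    intro m
    induction m with
    | zero => simp
    | succ m ih =>
      rw [pow_succ N, ← smul_mul_assoc, ih, add_mul, smul_mul_assoc, smul_mul_assoc, one_mul, hCH]
      module
  have hpow : (-q ^ 3) ^ k = (-q) ^ k := by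
    have : (-q ^ 3) = (-q) * q ^ 2 := by ring
    rw [this, mul_pow, ← pow_mul, hqk, mul_one]
  have h' : N ^ k = (-q) ^ k • (1 : Matrix (Fin 2) (Fin 2) ℂ) := by
    apply smul_right_injective _ hne
    simp only [key k, hpow]
    module
  rw [mem_center_iff_entries, Units.val_pow_eq_pow_val, Units.val_mul, ← hN, h']
  simp

end Burau

section Triangle

/-- The homomorphism from `F₂` to the Coxeter group of type `(k, k, k)` sending the generators to
the rotations `s₀ s₁` and `s₁ s₂`. -/
def rotationHom (k : ℕ) (hk : 2 ≤ k) :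
    FreeGroup (Fin 2) →* (equiCoxeterMatrix (Fin 3) k hk).Group :=
  FreeGroup.lift ![(equiCoxeterMatrix (Fin 3) k hk).simple 0 *
      (equiCoxeterMatrix (Fin 3) k hk).simple 1,
    (equiCoxeterMatrix (Fin 3) k hk).simple 1 * (equiCoxeterMatrix (Fin 3) k hk).simple 2]

theorem PresentedGroup.mk_eq_one_of_mem {α : Type*} {rels : Set (FreeGroup α)} {r : FreeGroup α}
    (h : r ∈ rels) : PresentedGroup.mk rels r = 1 :=
  (QuotientGroup.eq_one_iff r).2 (Subgroup.subset_normalClosure h)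

theorem triangle_relations (k : ℕ) :
    (PresentedGroup.of 0 : Triangle k k k) ^ k = 1 ∧ (PresentedGroup.of 1 : Triangle k k k) ^ k = 1 ∧
      ((PresentedGroup.of 0 : Triangle k k k) * PresentedGroup.of 1) ^ k = 1 := by
  refine ⟨?_, ?_, ?_⟩
  · exact PresentedGroup.mk_eq_one_of_mem (rels := triangleRels k k k)
      (r := FreeGroup.of 0 ^ k) (by simp [triangleRels])
  · exact PresentedGroup.mk_eq_one_of_mem (rels := triangleRels k k k)
      (r := FreeGroup.of 1 ^ k) (by simp [triangleRels])
  · exact PresentedGroup.mk_eq_one_of_mem (rels := triangleRels k k k)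
      (r := (FreeGroup.of 0 * FreeGroup.of 1) ^ k) (by simp [triangleRels])

/-- The endomorphism of `Δ(k,k,k)` inverting both generators. -/
def triangleInvHom (k : ℕ) : Triangle k k k →* Triangle k k k :=
  PresentedGroup.toGroup (f := fun i => (PresentedGroup.of i)⁻¹) (by
    obtain ⟨h0, h1, h2⟩ := triangle_relations k
    rintro r (rfl | rfl | rfl)
    · simp [h0]
    · simp [h1]
    · rw [map_pow, map_mul, FreeGroup.lift_apply_of, FreeGroup.lift_apply_of, ← _root_.mul_inv_rev,
        inv_pow, inv_eq_one]
      have : (PresentedGroup.of 1 : Triangle k k k) * PresentedGroup.of 0 =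
          (PresentedGroup.of 0)⁻¹ * (PresentedGroup.of 0 * PresentedGroup.of 1) *
            ((PresentedGroup.of 0)⁻¹)⁻¹ := by group
      rw [this, conj_pow, h2]
      group)

@[simp]
theorem triangleInvHom_of (k : ℕ) (i : Fin 2) :
    triangleInvHom k (PresentedGroup.of i) = (PresentedGroup.of i)⁻¹ :=
  PresentedGroup.toGroup.of _

theorem triangleInvHom_involutive (k : ℕ) : Function.Involutive (triangleInvHom k) := by
  have : (triangleInvHom k).comp (triangleInvHom k) = MonoidHom.id _ :=
    PresentedGroup.ext fun i => by simp
  exact fun a => DFunLike.congr_fun this a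

/-- The reflections of the triangle group, as permutations of its rotation subgroup. -/
noncomputable def triangleReflection (k : ℕ) : Fin 3 → Equiv.Perm (Triangle k k k) :=
  ![MulAction.toPermHom _ _ (PresentedGroup.of 0 : Triangle k k k) *
      (triangleInvHom_involutive k).toPerm,
    (triangleInvHom_involutive k).toPerm,
    (triangleInvHom_involutive k).toPerm *
      MulAction.toPermHom _ _ (PresentedGroup.of 1 : Triangle k k k)]

theorem triangleReflection_mul_self (k : ℕ) (i : Fin 3) :
    triangleReflection k i * triangleReflection k i = 1 := by
  ext a
  fin_cases i <;>
    simp [triangleReflection, triangleInvHom_involutive k a]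

theorem triangleReflection_zero_mul_one (k : ℕ) :
    triangleReflection k 0 * triangleReflection k 1 =
      MulAction.toPermHom _ _ (PresentedGroup.of 0 : Triangle k k k) := by
  have h := triangleReflection_mul_self k 1
  rw [show triangleReflection k 0 =
    MulAction.toPermHom _ _ (PresentedGroup.of 0 : Triangle k k k) * triangleReflection k 1 from rfl,
    mul_assoc, h, mul_one]

theorem triangleReflection_one_mul_two (k : ℕ) :
    triangleReflection k 1 * triangleReflection k 2 =
      MulAction.toPermHom _ _ (PresentedGroup.of 1 : Triangle k k k) := by
  have h := triangleReflection_mul_self k 1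
  rw [show triangleReflection k 2 = triangleReflection k 1 *
    MulAction.toPermHom _ _ (PresentedGroup.of 1 : Triangle k k k) from rfl,
    ← mul_assoc, h, one_mul]

theorem triangleReflection_isLiftable (k : ℕ) (hk : 2 ≤ k) :
    (equiCoxeterMatrix (Fin 3) k hk).IsLiftable (triangleReflection k) := by
  obtain ⟨h0, h1, h2⟩ := triangle_relations k
  have hsq := triangleReflection_mul_self k
  have h01 : (triangleReflection k 0 * triangleReflection k 1) ^ k = 1 := by
    rw [triangleReflection_zero_mul_one, ← map_pow, h0, map_one]
  have h12 : (triangleReflection k 1 * triangleReflection k 2) ^ k = 1 := by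
    rw [triangleReflection_one_mul_two, ← map_pow, h1, map_one]
  have h02 : (triangleReflection k 0 * triangleReflection k 2) ^ k = 1 := by
    have : triangleReflection k 0 * triangleReflection k 2 =
        (triangleReflection k 0 * triangleReflection k 1) *
          (triangleReflection k 1 * triangleReflection k 2) := by
      rw [mul_assoc, ← mul_assoc (triangleReflection k 1), hsq, one_mul]
    rw [this, triangleReflection_zero_mul_one, triangleReflection_one_mul_two, ← map_mul, ← map_pow,
      h2, map_one]
  have hsymm : ∀ i j, (triangleReflection k i * triangleReflection k j) ^ k = 1 →
      (triangleReflection k j * triangleReflection k i) ^ k = 1 := by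
    intro i j h
    rw [← inv_eq_one, ← inv_pow, _root_.mul_inv_rev, inv_eq_of_mul_eq_one_left (hsq i),
      inv_eq_of_mul_eq_one_left (hsq j), h]
  intro i j
  by_cases hij : i = j
  · subst hij
    simp [equiCoxeterMatrix, hsq]
  · have hM : (equiCoxeterMatrix (Fin 3) k hk) i j = k := by simp [equiCoxeterMatrix, hij]
    rw [hM]
    fin_cases i <;> fin_cases j <;> first
      | exact absurd rfl hij
      | assumption
      | exact hsymm _ _ ‹_›

theorem mem_normalClosure_of_rotationHom_eq_one {k : ℕ} (hk : 2 ≤ k) {w : FreeGroup (Fin 2)}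
    (hw : rotationHom k hk w = 1) : w ∈ Subgroup.normalClosure (triangleRels k k k) := by
  let cs := (equiCoxeterMatrix (Fin 3) k hk).toCoxeterSystem
  have hcomp : (cs.lift ⟨_, triangleReflection_isLiftable k hk⟩).comp (rotationHom k hk) =
      (MulAction.toPermHom (Triangle k k k) (Triangle k k k)).comp
        (PresentedGroup.mk (triangleRels k k k)) := by
    have hs := fun i => cs.lift_apply_simple (triangleReflection_isLiftable k hk) i
    refine FreeGroup.ext_hom _ _ fun i => ?_
    fin_cases i
    · have : rotationHom k hk (FreeGroup.of 0) = cs.simple 0 * cs.simple 1 := by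
        simp [rotationHom, cs]
      simp only [MonoidHom.comp_apply, Fin.zero_eta, this, map_mul, hs]
      exact triangleReflection_zero_mul_one k
    · have : rotationHom k hk (FreeGroup.of 1) = cs.simple 1 * cs.simple 2 := by
        simp [rotationHom, cs]
      simp only [MonoidHom.comp_apply, Fin.mk_one, this, map_mul, hs]
      exact triangleReflection_one_mul_two k
  have h := DFunLike.congr_fun hcomp w
  rw [MonoidHom.comp_apply, MonoidHom.comp_apply, hw, map_one] at h
  have h1 := Equiv.Perm.congr_fun h 1
  have h2 : PresentedGroup.mk (triangleRels k k k) w = 1 := by simpa using! h1.symm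
  exact (QuotientGroup.eq_one_iff w).1 h2

end Triangle

section Comparison

/-- The map carrying the simple roots to (non-normalised) half-turns in `PGL(2,ℂ)`. -/
def rootMatrix (q : ℂ) (v : Fin 3 → ℝ) : Matrix (Fin 2) (Fin 2) ℂ :=
  (v 0 : ℂ) • !![-1, q ^ 2 + 1; q - 1, 1] + (v 1 : ℂ) • !![q, 1 - q; q - q ^ 2, -q] +
    (v 2 : ℂ) • !![-q ^ 2, q ^ 2 - q; -1 - q ^ 2, q ^ 2]

theorem rootMatrix_injective {q : ℂ} (hq : q ^ 3 ≠ -1) : Function.Injective (rootMatrix q) := by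
  intro v w h
  have h00 := congr_fun (congr_fun h 0) 0
  have h01 := congr_fun (congr_fun h 0) 1
  have h10 := congr_fun (congr_fun h 1) 0
  simp [rootMatrix] at h00 h01 h10
  have hq' : 1 + q ^ 3 ≠ 0 := fun h => hq (by linear_combination h)
  have h2 : (v 2 : ℂ) = w 2 := by
    apply mul_left_cancel₀ hq'
    linear_combination (-1) * h10 + (1 - q) * h00
  have h1 : (v 1 : ℂ) = w 1 := by
    apply mul_left_cancel₀ hq'
    linear_combination h01 + (q ^ 2 + 1) * h00 + (q * (1 + q ^ 3)) * h2
  have h0 : (v 0 : ℂ) = w 0 := by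
    linear_combination - h00 + q * h1 - q ^ 2 * h2
  funext i
  fin_cases i
  · exact_mod_cast h0
  · exact_mod_cast h1
  · exact_mod_cast h2

theorem rootMatrix_mul_AGL {q : ℂ} (hq : q ≠ 0) {c : ℝ} (hc : (c : ℂ) = q + q⁻¹) (v : Fin 3 → ℝ) :
    rootMatrix q (equiReflection c 0 (equiReflection c 1 v)) * (AGL q).val =
      (AGL q).val * rootMatrix q v := by
  rw [coe_AGL hq]
  ext i j
  fin_cases i <;> fin_cases j <;>
    simp [rootMatrix, equiReflection_apply, Fin.sum_univ_three, Matrix.mul_apply, hc] <;>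
    field_simp <;> ring

theorem rootMatrix_mul_BGL {q : ℂ} (hq : q ≠ 0) {c : ℝ} (hc : (c : ℂ) = q + q⁻¹) (v : Fin 3 → ℝ) :
    rootMatrix q (equiReflection c 1 (equiReflection c 2 v)) * (BGL q).val =
      (BGL q).val * rootMatrix q v := by
  rw [coe_BGL hq]
  ext i j
  fin_cases i <;> fin_cases j <;>
    simp [rootMatrix, equiReflection_apply, Fin.sum_univ_three, Matrix.mul_apply, hc] <;>
    field_simp <;> ring

theorem equiReflection_isLiftable {k : ℕ} (hk : 2 ≤ k) :
    (equiCoxeterMatrix (Fin 3) k hk).IsLiftable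
      (equiReflection (2 * Real.cos (Real.pi / k))) := by
  intro i j
  by_cases hij : i = j
  · subst hij
    simp [equiCoxeterMatrix, equiReflection_mul_self]
  · have hM : (equiCoxeterMatrix (Fin 3) k hk) i j = k := by simp [equiCoxeterMatrix, hij]
    rw [hM]
    exact equiReflection_mul_pow hk hij

theorem rotationHom_eq_one_of_mem_center {k : ℕ} (hk : 2 ≤ k) {q : ℂ} (hq : q ≠ 0)
    (hq3 : q ^ 3 ≠ -1) (hc : ((2 * Real.cos (Real.pi / k) : ℝ) : ℂ) = q + q⁻¹)
    {w : FreeGroup (Fin 2)} (hw : burauHom q w ∈ Subgroup.center (GL (Fin 2) ℂ)) :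
    rotationHom k hk w = 1 := by
  let cs := (equiCoxeterMatrix (Fin 3) k hk).toCoxeterSystem
  let ρ := cs.lift ⟨_, equiReflection_isLiftable hk⟩
  have hs : ∀ i, ρ (cs.simple i) = equiReflection (2 * Real.cos (Real.pi / k)) i :=
    cs.lift_apply_simple (equiReflection_isLiftable hk)
  have hM : ∀ i j, i ≠ j → (equiCoxeterMatrix (Fin 3) k hk) i j = k := fun i j hij => by
    simp [equiCoxeterMatrix, hij]
  have hinj : Function.Injective ρ := by
    refine rho_injective cs ρ (fun i j hij => (hM i j hij).symm ▸ hk) (fun i => ?_)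
      fun i j hij => ?_
    · rw [hs, equiReflection_single_self]
    · rw [hs, hM i j hij, equiReflection_single_of_ne _ hij]
  have hconj : ∀ (u : FreeGroup (Fin 2)) (v : Fin 3 → ℝ),
      rootMatrix q (ρ (rotationHom k hk u) v) * (burauHom q u).val =
        (burauHom q u).val * rootMatrix q v := by
    intro u
    induction u using FreeGroup.induction_on with
    | C1 => simp
    | of i =>
      intro v
      fin_cases i
      · have h : rotationHom k hk (FreeGroup.of 0) = cs.simple 0 * cs.simple 1 := by
          simp [rotationHom, cs]
        simpa [h, hs, burauHom] using rootMatrix_mul_AGL hq hc v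
      · have h : rotationHom k hk (FreeGroup.of 1) = cs.simple 1 * cs.simple 2 := by
          simp [rotationHom, cs]
        simpa [h, hs, burauHom] using rootMatrix_mul_BGL hq hc v
    | inv_of i ih =>
      intro v
      have h := ih (ρ (rotationHom k hk (FreeGroup.of i)⁻¹) v)
      rw [← Module.End.mul_apply, ← map_mul, ← map_mul, mul_inv_cancel, map_one, map_one,
        Module.End.one_apply] at h
      rw [map_inv (burauHom q), Units.mul_inv_eq_iff_eq_mul, mul_assoc, h, ← mul_assoc,
        Units.inv_mul, one_mul]
    | mul x y hx hy =>
      intro v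
      rw [map_mul, map_mul, map_mul, Module.End.mul_apply, Units.val_mul, ← mul_assoc, hx,
        mul_assoc, hy, mul_assoc]
  apply hinj
  rw [map_one]
  refine LinearMap.ext fun v => rootMatrix_injective hq3 ?_
  obtain ⟨a, ha⟩ := Matrix.GeneralLinearGroup.mem_center_iff_val_mem_range_scalar.1 hw
  have h := hconj w v
  rw [← ha, (Matrix.scalar_commute a (fun r => Commute.all a r) (rootMatrix q v)).eq, ha] at h
  exact (burauHom q w).isUnit.mul_right_cancel h

end Comparison

theorem mem_normalClosure_of_burauHom_mem_center {k : ℕ} (hk : 2 ≤ k) (hk3 : k ≠ 3) {q : ℂ}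
    (hq : IsPrimitiveRoot q (2 * k)) {w : FreeGroup (Fin 2)}
    (hw : burauHom q w ∈ Subgroup.center (GL (Fin 2) ℂ)) :
    w ∈ Subgroup.normalClosure (triangleRels k k k) := by
  have hk0 : (k : ℂ) ≠ 0 := by exact_mod_cast (by omega : k ≠ 0)
  have hζ := Complex.isPrimitiveRoot_exp (2 * k) (by omega)
  set ζ := Complex.exp (2 * Real.pi * Complex.I / (2 * k : ℕ)) with hζdef
  have hζe : ζ = Complex.exp ((Real.pi / k : ℝ) * Complex.I) := by
    rw [hζdef]
    congr 1
    push_cast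
    field_simp
  have hζ3 : ζ ^ 3 ≠ -1 := by
    intro h
    have h6 : ζ ^ 6 = 1 := by
      rw [show 6 = 3 * 2 from rfl, pow_mul, h]
      norm_num
    have hdvd : k ∣ 3 := Nat.dvd_of_mul_dvd_mul_left two_pos (hζ.dvd_of_pow_eq_one 6 h6)
    rcases (Nat.dvd_prime Nat.prime_three).1 hdvd with h1 | h1 <;> omega
  have hc : ((2 * Real.cos (Real.pi / k) : ℝ) : ℂ) = ζ + ζ⁻¹ := by
    rw [hζe, ← Complex.exp_neg, ← neg_mul, Complex.ofReal_mul, Complex.ofReal_cos,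
      Complex.ofReal_ofNat, Complex.two_cos]
  exact mem_normalClosure_of_rotationHom_eq_one hk
    (rotationHom_eq_one_of_mem_center hk (hζ.ne_zero (by omega)) hζ3 hc
      (burauHom_mem_center_of_isPrimitiveRoot (by omega) hq hζ hw))

/-- Let `n = 2k` be even, `n ≠ 6`, and let `q` be a primitive `n`-th root of
unity. If `φ : F₂ → PGL(2,ℂ)` is the homomorphism from the free group on two generators
`x, y` with `φ(x) = [A(q)]` and `φ(y) = [B(q)]`, then `ker φ` is the normal closure of
`{x^k, y^k, (xy)^k}` in `F₂`. -/
theorem stmt5 (n k : ℕ) (hn : n = 2 * k) (hn0 : 0 < n) (hn6 : n ≠ 6)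
    (q : ℂ) (hq : IsPrimitiveRoot q n)
    (φ : FreeGroup (Fin 2) →* PGL2)
    (hφ0 : φ (FreeGroup.of 0) = Apr q) (hφ1 : φ (FreeGroup.of 1) = Bpr q) :
    φ.ker = Subgroup.normalClosure
      {(FreeGroup.of 0) ^ k, (FreeGroup.of 1) ^ k, (FreeGroup.of 0 * FreeGroup.of 1) ^ k} := by
  change φ.ker = Subgroup.normalClosure (triangleRels k k k)
  subst hn
  have hk : 0 < k := by omega
  have hφ : φ = pgl.comp (burauHom q) := by
    refine FreeGroup.ext_hom _ _ fun i => ?_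
    fin_cases i
    · simpa [burauHom, Apr] using hφ0
    · simpa [burauHom, Bpr] using hφ1
  have hker : ∀ w, w ∈ φ.ker ↔ burauHom q w ∈ Subgroup.center (GL (Fin 2) ℂ) := by
    intro w
    rw [hφ, MonoidHom.mem_ker, MonoidHom.comp_apply]
    exact QuotientGroup.eq_one_iff _
  apply le_antisymm
  · intro w hw
    by_cases hk1 : k = 1
    · subst hk1
      clear hw
      have hof : ∀ i : Fin 2, FreeGroup.of i ∈ Subgroup.normalClosure (triangleRels 1 1 1) := by
        intro i
        apply Subgroup.subset_normalClosure
        fin_cases i <;> simp [triangleRels]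
      induction w using FreeGroup.induction_on with
      | C1 => exact one_mem _
      | of i => exact hof i
      | inv_of i _ => exact inv_mem (hof i)
      | mul x y hx hy => exact mul_mem hx hy
    · exact mem_normalClosure_of_burauHom_mem_center (by omega) (by omega) hq ((hker w).1 hw)
  · refine Subgroup.normalClosure_le_normal ?_
    rintro r (rfl | rfl | rfl) <;> rw [SetLike.mem_coe, hker, map_pow]
    · simpa [burauHom] using AGL_pow_mem_center hk hq
    · simpa [burauHom] using BGL_pow_mem_center hk hq
    · simpa [burauHom] using AGL_mul_BGL_pow_mem_center hk hq
end
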